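/- arXiv:2505.06992 — 2 statements merged into one kernel-verified Lean document; each statement's English description precedes it below -/
import Mathlib

section
/- Let 1 < t < s and let I_{s,t} = (x_i y_j^{w_j} : 1 ≤ i ≤ s, 1 ≤ j ≤ t, i ≠ j) be the edge ideal of the weighted oriented unbalanced crown graph in R = K[x_1,...,x_s, y_1,...,y_t]. Then pdim(I_{s,t}) = s + t − 3 and β_{s+t-3,α}(I_{s,t}) = t−1 if x^α = x_1···x_s·y_1^{w_1}···y_t^{w_t}, and 0 otherwise. -/
open MvPolynomial

/-- A (multigraded) minimal free resolution of an ideal `I ⊆ K[x_v : v ∈ σ]`,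
recorded through the ranks `rk i` of its free modules, the multidegrees
`deg i j` of their basis elements, the augmentation `aug : F₀ → R` (whose image
is `I`) and the differentials `d i : F_{i+1} → F_i`, given by matrices. -/
structure MinFreeRes {K : Type} [Field K] {σ : Type} (I : Ideal (MvPolynomial σ K)) where
  rk : ℕ → ℕ
  deg : (i : ℕ) → Fin (rk i) → (σ →₀ ℕ)
  aug : (Fin (rk 0) → MvPolynomial σ K) →ₗ[MvPolynomial σ K] MvPolynomial σ K
  d : (i : ℕ) → Matrix (Fin (rk i)) (Fin (rk (i + 1))) (MvPolynomial σ K)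
  aug_homog : ∀ j, (aug (Pi.single j 1)).support ⊆ {deg 0 j}
  d_homog : ∀ i j k, ∀ m ∈ (d i j k).support, deg i j + m = deg (i + 1) k
  minimal : ∀ i j k, MvPolynomial.coeff (0 : σ →₀ ℕ) (d i j k) = 0
  range_aug : ∀ p, p ∈ LinearMap.range aug ↔ p ∈ I
  exact_zero : LinearMap.range (Matrix.mulVecLin (d 0)) = LinearMap.ker aug
  exact_succ : ∀ i,
    LinearMap.range (Matrix.mulVecLin (d (i + 1))) = LinearMap.ker (Matrix.mulVecLin (d i))

/-- The multigraded Betti number `β_{i,a}(I)`: the number of basis elements of the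
`i`-th free module in the minimal free resolution with multidegree `a`. -/
noncomputable def MinFreeRes.cnt {K : Type} [Field K] {σ : Type}
    {I : Ideal (MvPolynomial σ K)} (F : MinFreeRes I) (i : ℕ) (a : σ →₀ ℕ) : ℕ :=
  Nat.card {j : Fin (F.rk i) // F.deg i j = a}

/-- `F` witnesses that `pdim I = p`. -/
def MinFreeRes.IsPdim {K : Type} [Field K] {σ : Type}
    {I : Ideal (MvPolynomial σ K)} (F : MinFreeRes I) (p : ℕ) : Prop :=
  F.rk p ≠ 0 ∧ ∀ i, p < i → F.rk i = 0

/-- `F` witnesses that `reg I = r`, i.e. `r = max { |a| - i : β_{i,a}(I) ≠ 0 }`. -/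
def MinFreeRes.IsReg {K : Type} [Field K] {σ : Type}
    {I : Ideal (MvPolynomial σ K)} (F : MinFreeRes I) (r : ℤ) : Prop :=
  (∃ i j, ((F.deg i j).sum fun _ e => e : ℤ) - i = r) ∧
    ∀ i j, ((F.deg i j).sum fun _ e => e : ℤ) - i ≤ r

/-- `I` is a monomial ideal. -/
def IsMonomialIdeal {K : Type} [Field K] {σ : Type} (I : Ideal (MvPolynomial σ K)) : Prop :=
  ∃ S : Set (σ →₀ ℕ), I = Ideal.span ((fun a => monomial a (1 : K)) '' S)

/-! ### Abstract augmented complexes with a distinguished basis -/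

section Abstract

open Finsupp

/-- Exactness at level `n` of the span of the basis elements in `P`. -/
def ExAt {K B : Type} [Field K] (lvl : B → ℕ) (D : (B →₀ K) →ₗ[K] (B →₀ K))
    (P : Set B) (n : ℕ) : Prop :=
  ∀ z ∈ Finsupp.supported K K (P ∩ {k | lvl k = n}), D z = 0 →
    ∃ y ∈ Finsupp.supported K K (P ∩ {k | lvl k = n + 1}), D y = z

/-- The homology at level `n` of the span of `P` is one dimensional. -/
def OneAt {K B : Type} [Field K] (lvl : B → ℕ) (D : (B →₀ K) →ₗ[K] (B →₀ K))
    (P : Set B) (n : ℕ) : Prop :=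
  ∃ ζ ∈ Finsupp.supported K K (P ∩ {k | lvl k = n}), D ζ = 0 ∧
    (∀ y ∈ Finsupp.supported K K (P ∩ {k | lvl k = n + 1}), D y ≠ ζ) ∧
    ∀ z ∈ Finsupp.supported K K (P ∩ {k | lvl k = n}), D z = 0 →
      ∃ c : K, ∃ y ∈ Finsupp.supported K K (P ∩ {k | lvl k = n + 1}), z = c • ζ + D y

structure AC (K B Λ : Type) [Field K] [PartialOrder Λ] where
  o : B
  lvl : B → ℕ
  dg : B → Λ
  Good : Λ → Prop
  D : (B →₀ K) →ₗ[K] (B →₀ K)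
  lvl_o : lvl o = 0
  lvl_pos : ∀ k, k ≠ o → 0 < lvl k
  fin : ∀ n, {k | lvl k = n}.Finite
  DD : ∀ z, D (D z) = 0
  D_lvl : ∀ k b, D (single k 1) b ≠ 0 → lvl b + 1 = lvl k
  D_dg : ∀ k b, D (single k 1) b ≠ 0 → b = o ∨ dg b < dg k
  good_mono : ∀ a b, a ≤ b → Good a → Good b
  good_of : ∀ k, D (single k 1) o ≠ 0 → Good (dg k)
  ex_pos : ∀ a n, ExAt lvl D {k | k = o ∨ dg k ≤ a} (n + 1)
  ex_zero : ∀ a, Good a → ExAt lvl D {k | k = o ∨ dg k ≤ a} 0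

namespace AC

variable {K B Λ : Type} [Field K] [PartialOrder Λ] (A : AC K B Λ)

def P (a : Λ) : Set B := {k | k = A.o ∨ A.dg k ≤ a}

def L (n : ℕ) : Set B := {k | A.lvl k = n}

def Ex (P : Set B) (n : ℕ) : Prop := ExAt A.lvl A.D P n

def One (P : Set B) (n : ℕ) : Prop := OneAt A.lvl A.D P n

def Her (P : Set B) : Prop := ∀ k ∈ P, ∀ b, A.D (single k 1) b ≠ 0 → b ∈ P

def E (a : Λ) : Set B := {k | k ≠ A.o ∧ A.dg k = a}

lemma mem_supp {S : Set B} {z : B →₀ K} :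
    z ∈ Finsupp.supported K K S ↔ ∀ k, z k ≠ 0 → k ∈ S := by
  rw [Finsupp.mem_supported]
  constructor
  · intro h k hk
    exact h (by simpa using hk)
  · intro h k hk
    exact h k (by simpa using hk)

lemma D_apply_ne {z : B →₀ K} {b : B} (h : A.D z b ≠ 0) :
    ∃ k, z k ≠ 0 ∧ A.D (single k 1) b ≠ 0 := by
  by_contra! hc
  apply h
  have hz : z = z.sum fun k c => c • single k (1 : K) := by
    simp [Finsupp.sum_single]
  rw [hz, map_finsuppSum]
  simp only [map_smul, Finsupp.sum, Finsupp.coe_finsetSum, Finset.sum_apply, Finsupp.smul_apply,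
    smul_eq_mul]
  apply Finset.sum_eq_zero
  intro k hk
  rw [hc k (by simpa using hk), mul_zero]

lemma D_mem {P : Set B} (hP : A.Her P) {n : ℕ} {z : B →₀ K}
    (hz : z ∈ Finsupp.supported K K (P ∩ A.L (n + 1))) : A.D z ∈ Finsupp.supported K K (P ∩ A.L n) := by
  rw [mem_supp] at hz ⊢
  intro b hb
  obtain ⟨k, hk, hkb⟩ := A.D_apply_ne hb
  obtain ⟨h1, h2⟩ := hz k hk
  refine ⟨hP k h1 b hkb, ?_⟩
  have := A.D_lvl k b hkb
  simp only [L, Set.mem_ofPred_eq] at h2 ⊢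
  omega

lemma D_zero {P : Set B} {z : B →₀ K} (hz : z ∈ Finsupp.supported K K (P ∩ A.L 0)) : A.D z = 0 := by
  rw [mem_supp] at hz
  ext b
  by_contra hb
  obtain ⟨k, hk, hkb⟩ := A.D_apply_ne hb
  have h2 := (hz k hk).2
  have := A.D_lvl k b hkb
  simp only [L, Set.mem_ofPred_eq] at h2
  omega

lemma her_P (a : Λ) : A.Her (A.P a) := by
  intro k hk b hb
  rcases A.D_dg k b hb with h | h
  · exact Or.inl h
  · rcases hk with rfl | hk
    · have := A.D_lvl _ _ hb
      rw [A.lvl_o] at this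
      omega
    · exact Or.inr (h.le.trans hk)

lemma her_inter {P Q : Set B} (hP : A.Her P) (hQ : A.Her Q) : A.Her (P ∩ Q) :=
  fun k hk b hb => ⟨hP k hk.1 b hb, hQ k hk.2 b hb⟩

lemma her_union {P Q : Set B} (hP : A.Her P) (hQ : A.Her Q) : A.Her (P ∪ Q) :=
  fun k hk b hb => hk.imp (fun h => hP k h b hb) (fun h => hQ k h b hb)

lemma supp_mono {S T : Set B} (h : S ⊆ T) {z : B →₀ K} (hz : z ∈ Finsupp.supported K K S) :
    z ∈ Finsupp.supported K K T := supported_mono h hz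

lemma split {P Q R : Set B} {z : B →₀ K} (hz : z ∈ Finsupp.supported K K ((P ∪ Q) ∩ R)) :
    ∃ z1 ∈ Finsupp.supported K K (P ∩ R), ∃ z2 ∈ Finsupp.supported K K (Q ∩ R), z1 + z2 = z := by
  rw [Set.union_inter_distrib_right, supported_union] at hz
  exact Submodule.mem_sup.1 hz

lemma mem_both {P Q R : Set B} {z : B →₀ K} (h1 : z ∈ Finsupp.supported K K (P ∩ R))
    (h2 : z ∈ Finsupp.supported K K (Q ∩ R)) : z ∈ Finsupp.supported K K ((P ∩ Q) ∩ R) := by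
  rw [mem_supp] at *
  exact fun k hk => ⟨⟨(h1 k hk).1, (h2 k hk).1⟩, (h1 k hk).2⟩

lemma inl_mem {P Q R : Set B} {z : B →₀ K} (h : z ∈ Finsupp.supported K K ((P ∩ Q) ∩ R)) :
    z ∈ Finsupp.supported K K (P ∩ R) :=
  supp_mono (Set.inter_subset_inter_left _ Set.inter_subset_left) h

lemma inr_mem {P Q R : Set B} {z : B →₀ K} (h : z ∈ Finsupp.supported K K ((P ∩ Q) ∩ R)) :
    z ∈ Finsupp.supported K K (Q ∩ R) :=
  supp_mono (Set.inter_subset_inter_left _ Set.inter_subset_right) h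

lemma left_mem {P Q R : Set B} {z : B →₀ K} (h : z ∈ Finsupp.supported K K (P ∩ R)) :
    z ∈ Finsupp.supported K K ((P ∪ Q) ∩ R) :=
  supp_mono (Set.inter_subset_inter_left _ Set.subset_union_left) h

lemma right_mem {P Q R : Set B} {z : B →₀ K} (h : z ∈ Finsupp.supported K K (Q ∩ R)) :
    z ∈ Finsupp.supported K K ((P ∪ Q) ∩ R) :=
  supp_mono (Set.inter_subset_inter_left _ Set.subset_union_right) h

/-- splitting a cycle in a union, the common boundary being a cycle in the intersection -/
lemma split_cycle {P Q : Set B} (hP : A.Her P) (hQ : A.Her Q) {n : ℕ}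
    (hPQ : ∀ m, m + 1 = n → A.Ex (P ∩ Q) m) {z1 z2 : B →₀ K}
    (h1 : z1 ∈ Finsupp.supported K K (P ∩ A.L n)) (h2 : z2 ∈ Finsupp.supported K K (Q ∩ A.L n))
    (h : A.D (z1 + z2) = 0) :
    ∃ y ∈ Finsupp.supported K K ((P ∩ Q) ∩ A.L n), A.D y = A.D z1 := by
  rcases n with _ | m
  · exact ⟨0, zero_mem _, by rw [A.D_zero h1, map_zero]⟩
  · have h1' := A.D_mem hP h1
    have h2' := A.D_mem hQ h2
    have h3 : A.D z1 = - A.D z2 := by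
      rw [map_add] at h
      exact eq_neg_of_add_eq_zero_left h
    have h4 : A.D z1 ∈ Finsupp.supported K K (Q ∩ A.L m) := by
      rw [h3]
      exact neg_mem h2'
    exact hPQ m rfl _ (mem_both h1' h4) (A.DD _)

lemma mv_ex {P Q : Set B} (hP : A.Her P) (hQ : A.Her Q) {n : ℕ}
    (eP : A.Ex P n) (eQ : A.Ex Q n) (hPQ : ∀ m, m + 1 = n → A.Ex (P ∩ Q) m) :
    A.Ex (P ∪ Q) n := by
  intro z hz hD
  obtain ⟨z1, h1, z2, h2, rfl⟩ := split hz
  obtain ⟨y, hy, hyD⟩ := A.split_cycle hP hQ hPQ h1 h2 hD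
  obtain ⟨u1, hu1, hu1D⟩ := eP (z1 - y) (sub_mem h1 (inl_mem hy)) (by rw [map_sub, hyD, sub_self])
  obtain ⟨u2, hu2, hu2D⟩ := eQ (z2 + y) (add_mem h2 (inr_mem hy))
    (by rw [map_add, hyD, add_comm, ← map_add, hD])
  exact ⟨u1 + u2, add_mem (left_mem hu1) (right_mem hu2), by rw [map_add, hu1D, hu2D]; abel⟩

lemma mv_one_shift {P Q : Set B} (hP : A.Her P) (hQ : A.Her Q) {n : ℕ}
    (eP : ∀ n, A.Ex P n) (eQ : ∀ n, A.Ex Q n) (hPQ : A.One (P ∩ Q) n) :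
    A.One (P ∪ Q) (n + 1) := by
  obtain ⟨ζ, hζ, hD, hnb, hgen⟩ := hPQ
  obtain ⟨y1, hy1, hy1D⟩ := eP n ζ (inl_mem hζ) hD
  obtain ⟨y2, hy2, hy2D⟩ := eQ n ζ (inr_mem hζ) hD
  refine ⟨y1 - y2, sub_mem (left_mem hy1) (right_mem hy2), by rw [map_sub, hy1D, hy2D, sub_self],
    ?_, ?_⟩
  · intro y hy h
    obtain ⟨w1, hw1, w2, hw2, rfl⟩ := split hy
    have e : y1 - A.D w1 = y2 + A.D w2 := by
      rw [map_add] at h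
      rw [sub_eq_iff_eq_add, add_assoc, add_comm (A.D w2), h]
      abel
    refine hnb (y1 - A.D w1) (mem_both (sub_mem hy1 (A.D_mem hP hw1)) ?_) ?_
    · rw [e]
      exact add_mem hy2 (A.D_mem hQ hw2)
    · rw [map_sub, A.DD, hy1D, sub_zero]
  · intro z hz hDz
    obtain ⟨z1, h1, z2, h2, rfl⟩ := split hz
    have h3 : A.D z1 = - A.D z2 := by
      rw [map_add] at hDz
      exact eq_neg_of_add_eq_zero_left hDz
    have h4 : A.D z1 ∈ Finsupp.supported K K (Q ∩ A.L n) := by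
      rw [h3]
      exact neg_mem (A.D_mem hQ h2)
    obtain ⟨c, y, hy, hc⟩ := hgen _ (mem_both (A.D_mem hP h1) h4) (A.DD _)
    obtain ⟨u1, hu1, hu1D⟩ := eP (n + 1) (z1 - c • y1 - y)
      (sub_mem (sub_mem h1 (Submodule.smul_mem _ _ hy1)) (inl_mem hy))
      (by rw [map_sub, map_sub, map_smul, hy1D, hc]; abel)
    obtain ⟨u2, hu2, hu2D⟩ := eQ (n + 1) (z2 + c • y2 + y)
      (add_mem (add_mem h2 (Submodule.smul_mem _ _ hy2)) (inr_mem hy))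
      (by
        have : A.D z2 = - (c • ζ + A.D y) := by rw [← hc, h3, neg_neg]
        rw [map_add, map_add, map_smul, hy2D, this]; abel)
    refine ⟨c, u1 + u2, add_mem (left_mem hu1) (right_mem hu2), ?_⟩
    rw [map_add, hu1D, hu2D, smul_sub]
    abel

lemma mv_one {P Q : Set B} (hP : A.Her P) (hQ : A.Her Q) {n : ℕ}
    (oP : A.One P n) (eQ : ∀ n, A.Ex Q n) (hPQ : ∀ n, A.Ex (P ∩ Q) n) :
    A.One (P ∪ Q) n := by
  obtain ⟨ζ, hζ, hD, hnb, hgen⟩ := oP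
  refine ⟨ζ, left_mem hζ, hD, ?_, ?_⟩
  · intro y hy h
    obtain ⟨w1, hw1, w2, hw2, rfl⟩ := split hy
    have e : ζ - A.D w1 = A.D w2 := by
      rw [← h, map_add]
      abel
    have hm : A.D w2 ∈ Finsupp.supported K K (P ∩ A.L n) := by
      rw [← e]
      exact sub_mem hζ (A.D_mem hP hw1)
    obtain ⟨y', hy', hy'D⟩ := hPQ n _ (mem_both hm (A.D_mem hQ hw2)) (A.DD _)
    refine hnb (w1 + y') (add_mem hw1 (inl_mem hy')) ?_
    rw [map_add, hy'D, ← map_add, h]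
  · intro z hz hDz
    obtain ⟨z1, h1, z2, h2, rfl⟩ := split hz
    obtain ⟨y, hy, hyD⟩ := A.split_cycle hP hQ (fun m _ => hPQ m) h1 h2 hDz
    obtain ⟨c, u1, hu1, hu1D⟩ := hgen (z1 - y) (sub_mem h1 (inl_mem hy))
      (by rw [map_sub, hyD, sub_self])
    obtain ⟨u2, hu2, hu2D⟩ := eQ n (z2 + y) (add_mem h2 (inr_mem hy))
      (by rw [map_add, hyD, add_comm, ← map_add, hDz])
    refine ⟨c, u1 + u2, add_mem (left_mem hu1) (right_mem hu2), ?_⟩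
    have : z1 + z2 = (z1 - y) + (z2 + y) := by abel
    rw [this, hu1D, map_add, hu2D]
    abel

/-- minimality -/
lemma cycle_top {a : Λ} {n : ℕ} {z : B →₀ K} (hz : z ∈ Finsupp.supported K K (A.P a ∩ A.L (n + 1)))
    (hD : A.D z = 0) {k : B} (hk : k ∈ A.E a) : z k = 0 := by
  obtain ⟨u, hu, rfl⟩ := A.ex_pos a n z hz hD
  by_contra h
  obtain ⟨j, hj, hjk⟩ := A.D_apply_ne h
  have hj' := ((mem_supp.1 hu) j hj).1
  rcases A.D_dg j k hjk with h1 | h1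
  · exact hk.1 h1
  · rcases hj' with rfl | h2
    · have := A.D_lvl _ _ hjk
      rw [A.lvl_o] at this
      omega
    · rw [hk.2] at h1
      exact absurd (lt_of_lt_of_le h1 h2) (lt_irrefl _)

lemma lvl_succ {k : B} (hk : k ≠ A.o) : ∃ n, A.lvl k = n + 1 :=
  ⟨A.lvl k - 1, by have := A.lvl_pos k hk; omega⟩

lemma D_single_ne {k : B} (hk : k ≠ A.o) : A.D (single k 1) ≠ 0 := by
  intro h
  obtain ⟨n, hn⟩ := A.lvl_succ hk
  have := A.cycle_top (a := A.dg k) (n := n) (z := single k 1)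
    (Finsupp.single_mem_supported K _ ⟨Or.inr le_rfl, hn⟩) h (k := k) ⟨hk, rfl⟩
  simp at this

lemma D_single_exists {k : B} (hk : k ≠ A.o) : ∃ b, A.D (single k 1) b ≠ 0 := by
  by_contra! h
  exact A.D_single_ne hk (by ext b; exact h b)

lemma good_aux (n : ℕ) : ∀ k, k ≠ A.o → A.lvl k = n → A.Good (A.dg k) := by
  induction n using Nat.strong_induction_on with
  | _ n ih =>
    intro k hk hn
    obtain ⟨b, hb⟩ := A.D_single_exists hk
    by_cases hbo : b = A.o
    · subst hbo
      exact A.good_of k hb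
    · have h1 := A.D_lvl k b hb
      have h2 := (A.D_dg k b hb).resolve_left hbo
      exact A.good_mono _ _ h2.le (ih (A.lvl b) (by omega) b hbo rfl)

lemma good {k : B} (hk : k ≠ A.o) : A.Good (A.dg k) := A.good_aux _ k hk rfl

lemma ex_P {a : Λ} (ha : A.Good a) (n : ℕ) : A.Ex (A.P a) n := by
  rcases n with _ | n
  · exact A.ex_zero a ha
  · exact A.ex_pos a n

lemma P_bad {a : Λ} (ha : ¬ A.Good a) : A.P a = {A.o} := by
  ext k
  constructor
  · rintro (h | h)
    · exact h
    · by_contra hk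
      exact ha (A.good_mono _ _ h (A.good hk))
  · intro h
    exact Or.inl h

/-- removal of redundant degrees -/
lemma no_bad (Bad : Λ → Prop)
    (h : ∀ b, Bad b → A.Good b → ∃ b', b' < b ∧ A.Good b' ∧
      ∀ c ≤ b, A.Good c → ¬ Bad c → c ≤ b') :
    ∀ n, ∀ k, k ≠ A.o → A.lvl k = n → ¬ Bad (A.dg k) := by
  intro n
  induction n using Nat.strong_induction_on with
  | _ n ih =>
    intro k hk hn hbad
    obtain ⟨b', hlt, hg, hc⟩ := h _ hbad (A.good hk)
    obtain ⟨m, hm⟩ := A.lvl_succ hk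
    have hs : single k (1 : K) ∈ Finsupp.supported K K (A.P (A.dg k) ∩ A.L (m + 1)) :=
      Finsupp.single_mem_supported K _ ⟨Or.inr le_rfl, hm⟩
    have h1 : A.D (single k 1) ∈ Finsupp.supported K K (A.P b' ∩ A.L m) := by
      rw [mem_supp]
      intro b hb
      have hl := A.D_lvl k b hb
      refine ⟨?_, by simp only [L, Set.mem_ofPred_eq]; omega⟩
      by_cases hbo : b = A.o
      · exact Or.inl hbo
      · have h2 := (A.D_dg k b hb).resolve_left hbo
        exact Or.inr (hc _ h2.le (A.good hbo) (ih (A.lvl b) (by omega) b hbo rfl))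
    obtain ⟨z, hz, hzD⟩ := A.ex_P hg m _ h1 (A.DD _)
    have hz' : z ∈ Finsupp.supported K K (A.P (A.dg k) ∩ A.L (m + 1)) :=
      supp_mono (Set.inter_subset_inter_left _ (fun j hj => hj.imp id (fun h => h.trans hlt.le))) hz
    have h3 := A.cycle_top (sub_mem hs hz') (by rw [map_sub, hzD, sub_self]) (k := k) ⟨hk, rfl⟩
    have h4 : z k = 0 := by
      by_contra h4
      rcases ((mem_supp.1 hz) k h4).1 with h5 | h5
      · exact hk h5
      · exact absurd (lt_of_lt_of_le hlt h5) (lt_irrefl _)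
    simp [h4] at h3

end AC

end Abstract
/-! ### Degrees in a Boolean lattice -/

section Boolean

set_option linter.unusedSectionVars false
set_option linter.unusedVariables false

open Finsupp

namespace AC

variable {K B V : Type} [Field K] [DecidableEq V] (A : AC K B (Finset V))

def Uw (W a : Finset V) : Set B := {k | k = A.o ∨ (A.dg k ≤ a ∧ ∃ u ∈ W, u ∉ A.dg k)}

lemma le_erase {c a : Finset V} {u : V} : c ≤ a.erase u ↔ c ≤ a ∧ u ∉ c := by
  simp only [Finset.subset_erase]

lemma Uw_insert (u : V) (W a : Finset V) :
    A.Uw (insert u W) a = A.Uw W a ∪ A.P (a.erase u) := by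
  ext k
  simp only [Uw, P, Set.mem_ofPred_eq, Set.mem_union, le_erase, Finset.mem_insert]
  constructor
  · rintro (h | ⟨h, v, rfl | hv, hvk⟩)
    · exact Or.inl (Or.inl h)
    · exact Or.inr (Or.inr ⟨h, hvk⟩)
    · exact Or.inl (Or.inr ⟨h, v, hv, hvk⟩)
  · rintro ((h | ⟨h, v, hv, hvk⟩) | h | ⟨h, hu⟩)
    · exact Or.inl h
    · exact Or.inr ⟨h, v, Or.inr hv, hvk⟩
    · exact Or.inl h
    · exact Or.inr ⟨h, u, Or.inl rfl, hu⟩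

lemma Uw_inter (u : V) (W a : Finset V) :
    A.Uw W a ∩ A.P (a.erase u) = A.Uw W (a.erase u) := by
  ext k
  simp only [Uw, P, Set.mem_ofPred_eq, Set.mem_inter_iff, le_erase]
  tauto

lemma Uw_singleton (u : V) (a : Finset V) : A.Uw {u} a = A.P (a.erase u) := by
  ext k
  simp only [Uw, P, Set.mem_ofPred_eq, le_erase, Finset.mem_singleton, exists_eq_left]

lemma her_Uw (W a : Finset V) : A.Her (A.Uw W a) := by
  intro k hk b hb
  rcases A.D_dg k b hb with h | h
  · exact Or.inl h
  · rcases hk with rfl | ⟨hk, u, hu, huk⟩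
    · have := A.D_lvl _ _ hb
      rw [A.lvl_o] at this
      omega
    · exact Or.inr ⟨h.le.trans hk, u, hu, fun hub => huk (h.le hub)⟩

/-- Cone lemma. -/
lemma ex_Uw (u0 : V) (W : Finset V) : ∀ a : Finset V, A.Good a →
    (∀ c ≤ a, a \ W ⊆ c → A.Good c → A.Good (c.erase u0)) →
    ∀ n, A.Ex (A.Uw (insert u0 W) a) n := by
  induction W using Finset.induction_on with
  | empty =>
    intro a ha h n
    have : insert u0 (∅ : Finset V) = {u0} := rfl
    rw [this, Uw_singleton]
    exact A.ex_P (h a le_rfl (by simp) ha) n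
  | insert u W hu ih =>
    intro a ha h n
    have hW : ∀ n, A.Ex (A.Uw (insert u0 W) a) n :=
      ih a ha (fun c hc hs => h c hc (fun x hx => hs (by
        simp only [Finset.mem_sdiff, Finset.mem_insert] at hx ⊢; tauto)))
    rw [Finset.insert_comm, Uw_insert]
    by_cases hg : A.Good (a.erase u)
    · refine A.mv_ex (A.her_Uw _ _) (A.her_P _) (hW n) (A.ex_P hg n) (fun m _ => ?_)
      rw [Uw_inter]
      refine ih _ hg (fun c hc hs => h c (hc.trans (Finset.erase_subset _ _)) ?_) m
      intro x hx
      apply hs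
      simp only [Finset.mem_sdiff, Finset.mem_insert, Finset.mem_erase] at hx ⊢
      tauto
    · rw [A.P_bad hg, Set.union_eq_left.2]
      · exact hW n
      · rintro k rfl
        exact Or.inl rfl

/-- Sphere lemma. -/
lemma one_Uw (x y : V) (hxy : ¬ A.Good {x, y})
    (h3 : ∀ c : Finset V, x ∈ c → y ∈ c → ∀ u ∈ c, u ≠ x → u ≠ y → A.Good c) (W : Finset V) :
    x ∉ W → y ∉ W → W.Nonempty →
      (∀ n, n + 1 ≠ W.card → A.Ex (A.Uw W (insert x (insert y W))) n) ∧
      ∀ n, n + 1 = W.card → A.One (A.Uw W (insert x (insert y W))) n := by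
  induction W using Finset.induction_on with
  | empty => intro _ _ h; simp at h
  | insert u W hu ih =>
    intro hx hy _
    simp only [Finset.mem_insert, not_or] at hx hy
    have he : (insert x (insert y (insert u W))).erase u = insert x (insert y W) := by
      ext v
      simp only [Finset.mem_insert, Finset.mem_erase]
      constructor
      · tauto
      · rintro (rfl | rfl | h)
        · tauto
        · tauto
        · refine ⟨?_, by tauto⟩
          rintro rfl
          exact hu h
    rcases W.eq_empty_or_nonempty with rfl | hne
    · have h1 : insert u (∅ : Finset V) = {u} := rfl
      have h2 : A.Uw (insert u (∅ : Finset V)) (insert x (insert y (insert u ∅))) = {A.o} := by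
        rw [h1, Uw_singleton, ← h1, he, P_bad]
        exact hxy
      rw [h2, Finset.card_insert_of_notMem hu, Finset.card_empty]
      constructor
      · intro n hn z hz _
        refine ⟨0, zero_mem _, ?_⟩
        rw [map_zero]
        ext k
        by_contra hk
        obtain ⟨h1, h2⟩ := (mem_supp.1 hz) k (Ne.symm hk)
        rw [Set.mem_singleton_iff] at h1
        simp only [Set.mem_ofPred_eq, h1, A.lvl_o] at h2
        omega
      · intro n hn
        obtain rfl : n = 0 := by omega
        have hm : single A.o (1 : K) ∈ Finsupp.supported K K ({A.o} ∩ {k | A.lvl k = 0}) :=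
          Finsupp.single_mem_supported K _ ⟨rfl, A.lvl_o⟩
        refine ⟨single A.o 1, hm, A.D_zero hm, ?_, ?_⟩
        · intro w hw h
          have : w = 0 := by
            ext k
            by_contra hk
            obtain ⟨h1, h2⟩ := (mem_supp.1 hw) k hk
            rw [Set.mem_singleton_iff] at h1
            simp only [Set.mem_ofPred_eq, h1, A.lvl_o] at h2
            omega
          rw [this, map_zero] at h
          have := DFunLike.congr_fun h A.o
          simp at this
        · intro z hz _
          refine ⟨z A.o, 0, zero_mem _, ?_⟩
          ext k
          by_cases hk : k = A.o
          · subst hk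
            simp
          · have : z k = 0 := by
              by_contra hzk
              exact hk ((mem_supp.1 hz) k hzk).1
            simp [this, Ne.symm hk]
    · obtain ⟨ihE, ihO⟩ := ih hx.2 hy.2 hne
      rw [Uw_insert, he]
      have eQ : ∀ n, A.Ex (A.P (insert x (insert y W))) n := by
        obtain ⟨v, hv⟩ := hne
        refine A.ex_P (h3 _ (by simp) (by simp) v (by simp [hv]) ?_ ?_)
        · rintro rfl
          exact hx.2 hv
        · rintro rfl
          exact hy.2 hv
      have eP : ∀ n, A.Ex (A.Uw W (insert x (insert y (insert u W)))) n := by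
        obtain ⟨v, hv⟩ := hne
        have hW : insert v (W.erase v) = W := Finset.insert_erase hv
        have hvu : u ≠ v := by
          rintro rfl
          exact hu hv
        have hxv : x ≠ v := by
          rintro rfl
          exact hx.2 hv
        have hyv : y ≠ v := by
          rintro rfl
          exact hy.2 hv
        have := A.ex_Uw v (W.erase v) (insert x (insert y (insert u W)))
          (h3 _ (by simp) (by simp) u (by simp) (Ne.symm hx.1) (Ne.symm hy.1)) (by
            intro c _ hs _
            have hxc : x ∈ c := hs (by simp [hx.2])
            have hyc : y ∈ c := hs (by simp [hy.2])
            have huc : u ∈ c := hs (by simp [hu])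
            exact h3 _ (by simp [hxc, hxv]) (by simp [hyc, hyv]) u (by simp [huc, hvu])
              (Ne.symm hx.1) (Ne.symm hy.1))
        rw [hW] at this
        exact this
      have hIntr : A.Uw W (insert x (insert y (insert u W))) ∩ A.P (insert x (insert y W)) =
          A.Uw W (insert x (insert y W)) := by
        rw [← he, Uw_inter]
      rw [Finset.card_insert_of_notMem hu]
      constructor
      · intro n hn
        refine A.mv_ex (A.her_Uw _ _) (A.her_P _) (eP n) (eQ n) (fun m hm => ?_)
        rw [hIntr]
        exact ihE m (by omega)
      · intro n hn
        rcases n with _ | n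
        · have := hne.card_pos
          omega
        · refine A.mv_one_shift (A.her_Uw _ _) (A.her_P _) eP eQ ?_
          rw [hIntr]
          exact ihO n (by omega)

/-! Counting basis elements. -/

lemma mem_BB {a : Finset V} {v : V} (hv : v ∈ a) {k : B} :
    k ∈ A.Uw (a.erase v) a ↔ k = A.o ∨ (A.dg k ≤ a ∧ A.dg k ≠ a ∧ A.dg k ≠ a.erase v) := by
  simp only [Uw, Set.mem_ofPred_eq]
  refine or_congr_right (and_congr_right fun hle => ?_)
  constructor
  · rintro ⟨u, hu, huk⟩
    rw [Finset.mem_erase] at hu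
    refine ⟨fun h => huk (h ▸ hu.2), fun h => huk ?_⟩
    rw [h, Finset.mem_erase]
    exact hu
  · rintro ⟨h1, h2⟩
    by_contra! hc
    have h3 : a.erase v ≤ A.dg k := hc
    by_cases hvk : v ∈ A.dg k
    · apply h1
      apply le_antisymm hle
      intro u hu
      by_cases huv : u = v
      · rw [huv]; exact hvk
      · exact h3 (Finset.mem_erase.2 ⟨huv, hu⟩)
    · exact h2 (le_antisymm (le_erase.2 ⟨hle, hvk⟩) h3)

lemma BB_sub_P (W a : Finset V) : A.Uw W a ⊆ A.P a := fun _ hk => hk.imp id And.left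

lemma E_sub_P {a b : Finset V} (h : b ≤ a) : A.E b ⊆ A.P a := fun _ hk => Or.inr (hk.2.le.trans h)

/-- boundary of something of top degree -/
lemma D_E_mem {a : Finset V} {v : V} (hv : v ∈ a) {m : ℕ} {z : B →₀ K}
    (hz : z ∈ Finsupp.supported K K (A.E a ∩ A.L (m + 1))) (h0 : ∀ b ∈ A.E (a.erase v), A.D z b = 0) :
    A.D z ∈ Finsupp.supported K K (A.Uw (a.erase v) a ∩ A.L m) := by
  have h1 := A.D_mem (A.her_P a) (supp_mono (Set.inter_subset_inter_left _ (A.E_sub_P le_rfl)) hz)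
  rw [mem_supp] at h1 ⊢
  intro b hb
  refine ⟨?_, (h1 b hb).2⟩
  rw [A.mem_BB hv]
  by_cases hbo : b = A.o
  · exact Or.inl hbo
  · obtain ⟨k, hk, hkb⟩ := A.D_apply_ne hb
    have h2 := (A.D_dg k b hkb).resolve_left hbo
    have h3 := ((mem_supp.1 hz) k hk).1.2
    rw [h3] at h2
    exact Or.inr ⟨h2.le, h2.ne, fun h => hb (h0 b ⟨hbo, h⟩)⟩

lemma BB_E {a : Finset V} {v : V} (hv : v ∈ a) {R : Set B} {y : B →₀ K}
    (hy : y ∈ Finsupp.supported K K (A.Uw (a.erase v) a ∩ R)) {k : B} (hk : k ∈ A.E a) : y k = 0 := by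
  by_contra h
  have := ((mem_supp.1 hy) k h).1
  rw [A.mem_BB hv] at this
  rcases this with h1 | h1
  · exact hk.1 h1
  · exact h1.2.1 hk.2

lemma BB_E' {a : Finset V} {v : V} (hv : v ∈ a) {R : Set B} {y : B →₀ K}
    (hy : y ∈ Finsupp.supported K K (A.Uw (a.erase v) a ∩ R)) {k : B} (hk : k ∈ A.E (a.erase v)) :
    y k = 0 := by
  by_contra h
  have := ((mem_supp.1 hy) k h).1
  rw [A.mem_BB hv] at this
  rcases this with h1 | h1
  · exact hk.1 h1
  · exact h1.2.2 hk.2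

lemma eq_of_E {S : Set B} {z z' : B →₀ K} (hz : z ∈ Finsupp.supported K K S) (hz' : z' ∈ Finsupp.supported K K S)
    (h : ∀ k ∈ S, z k = z' k) : z = z' := by
  ext k
  by_cases hk : k ∈ S
  · exact h k hk
  · have h1 : z k = 0 := by
      by_contra h1
      exact hk ((mem_supp.1 hz) k h1)
    have h2 : z' k = 0 := by
      by_contra h2
      exact hk ((mem_supp.1 hz') k h2)
    rw [h1, h2]

lemma inj_aux {a : Finset V} {v : V} (hv : v ∈ a) {m : ℕ} (hE : A.Ex (A.Uw (a.erase v) a) m)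
    {z : B →₀ K} (hz : z ∈ Finsupp.supported K K (A.E a ∩ A.L (m + 1)))
    (h0 : ∀ b ∈ A.E (a.erase v), A.D z b = 0) : z = 0 := by
  obtain ⟨y, hy, hyD⟩ := hE _ (A.D_E_mem hv hz h0) (A.DD _)
  refine eq_of_E hz (zero_mem _) (fun k hk => ?_)
  have h1 := A.cycle_top (a := a) (n := m) (z := z - y)
    (sub_mem (supp_mono (Set.inter_subset_inter_left _ (A.E_sub_P le_rfl)) hz)
      (supp_mono (Set.inter_subset_inter_left _ (A.BB_sub_P _ _)) hy))
    (by rw [map_sub, hyD, sub_self]) hk.1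
  rw [Finsupp.sub_apply, A.BB_E hv hy hk.1, sub_zero] at h1
  exact h1

lemma surj_aux {a : Finset V} {v : V} (hv : v ∈ a) {m : ℕ}
    (hE : ∀ n, n + 1 = m → A.Ex (A.Uw (a.erase v) a) n)
    {z : B →₀ K} (hz : z ∈ Finsupp.supported K K (A.E (a.erase v) ∩ A.L m)) :
    ∃ u ∈ Finsupp.supported K K (A.E a ∩ A.L (m + 1)), ∀ b ∈ A.E (a.erase v), A.D u b = z b := by
  classical
  rcases m with _ | n
  · refine ⟨0, zero_mem _, fun b hb => ?_⟩
    have : z b = 0 := by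
      by_contra h
      have h1 := ((mem_supp.1 hz) b h).2
      have := A.lvl_pos b hb.1
      simp only [L, Set.mem_ofPred_eq] at h1
      omega
    simp [this]
  · have hle : a.erase v ≤ a := Finset.erase_subset _ _
    have hDz : A.D z ∈ Finsupp.supported K K (A.Uw (a.erase v) a ∩ A.L n) := by
      have h1 := A.D_mem (A.her_P a) (supp_mono (Set.inter_subset_inter_left _ (A.E_sub_P hle)) hz)
      rw [mem_supp] at h1 ⊢
      intro b hb
      refine ⟨?_, (h1 b hb).2⟩
      rw [A.mem_BB hv]
      by_cases hbo : b = A.o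
      · exact Or.inl hbo
      · obtain ⟨k, hk, hkb⟩ := A.D_apply_ne hb
        have h2 := (A.D_dg k b hkb).resolve_left hbo
        have h3 := ((mem_supp.1 hz) k hk).1.2
        rw [h3] at h2
        exact Or.inr ⟨h2.le.trans hle, (lt_of_lt_of_le h2 hle).ne, h2.ne⟩
    obtain ⟨y, hy, hyD⟩ := hE n rfl _ hDz (A.DD _)
    obtain ⟨u, hu, huD⟩ := A.ex_pos a n (z - y)
      (sub_mem (supp_mono (Set.inter_subset_inter_left _ (A.E_sub_P hle)) hz)
        (supp_mono (Set.inter_subset_inter_left _ (A.BB_sub_P _ _)) hy))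
      (by rw [map_sub]; exact sub_eq_zero.2 hyD.symm)
    refine ⟨u.filter (· ∈ A.E a), ?_, ?_⟩
    · rw [mem_supp]
      intro k hk
      by_cases hka : k ∈ A.E a
      · rw [Finsupp.filter_apply_pos _ _ hka] at hk
        exact ⟨hka, ((mem_supp.1 hu) k hk).2⟩
      · rw [Finsupp.filter_apply_neg _ _ hka] at hk
        exact absurd rfl hk
    · intro b hb
      have hrest : A.D (u.filter (fun k => ¬ k ∈ A.E a)) b = 0 := by
        by_contra h
        obtain ⟨k, hk, hkb⟩ := A.D_apply_ne h
        by_cases hka : k ∈ A.E a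
        · rw [Finsupp.filter_apply_neg (fun k => ¬ k ∈ A.E a) _ (not_not.2 hka)] at hk
          exact hk rfl
        · rw [Finsupp.filter_apply_pos (fun k => ¬ k ∈ A.E a) _ hka] at hk
          have h2 := (A.D_dg k b hkb).resolve_left hb.1
          rw [hb.2] at h2
          have hko : k ≠ A.o := by
            rintro rfl
            have := A.D_lvl _ _ hkb
            rw [A.lvl_o] at this
            omega
          have h3 : A.dg k ≤ a := ((mem_supp.1 hu) k hk).1.resolve_left hko
          apply hka
          refine ⟨hko, ?_⟩
          by_contra hne
          by_cases hvk : v ∈ A.dg k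
          · apply hne
            apply le_antisymm h3
            intro w hw
            by_cases hwv : w = v
            · rw [hwv]; exact hvk
            · exact h2.le (Finset.mem_erase.2 ⟨hwv, hw⟩)
          · exact absurd (lt_of_lt_of_le h2 (le_erase.2 ⟨h3, hvk⟩)) (lt_irrefl _)
      have hsum : A.D (u.filter (· ∈ A.E a)) + A.D (u.filter (fun k => ¬ k ∈ A.E a)) = A.D u := by
        rw [← map_add, Finsupp.filter_add_filter_not]
      have h5 := DFunLike.congr_fun hsum b
      rw [Finsupp.add_apply, hrest, add_zero, huD, Finsupp.sub_apply, A.BB_E' hv hy hb, sub_zero] at h5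
      exact h5

lemma one_aux {a : Finset V} {v : V} (hv : v ∈ a) (hg : A.Good a) {m : ℕ}
    (hO : A.One (A.Uw (a.erase v) a) m) (hne : A.E (a.erase v) ∩ A.L (m + 1) = ∅) :
    ∃ z ∈ Finsupp.supported K K (A.E a ∩ A.L (m + 1)), z ≠ 0 ∧ (∀ b ∈ A.E (a.erase v), A.D z b = 0) ∧
      ∀ z' ∈ Finsupp.supported K K (A.E a ∩ A.L (m + 1)), (∀ b ∈ A.E (a.erase v), A.D z' b = 0) →
        ∃ c : K, z' = c • z := by
  classical
  obtain ⟨ζ, hζ, hD, hnb, hgen⟩ := hO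
  obtain ⟨u, hu, huD⟩ := A.ex_P hg m ζ
    (supp_mono (Set.inter_subset_inter_left _ (A.BB_sub_P _ _)) hζ) hD
  have hsplit : u.filter (· ∈ A.E a) + u.filter (fun k => ¬ k ∈ A.E a) = u :=
    Finsupp.filter_add_filter_not _ _
  have h1 : u.filter (· ∈ A.E a) ∈ Finsupp.supported K K (A.E a ∩ A.L (m + 1)) := by
    rw [mem_supp]
    intro k hk
    by_cases hka : k ∈ A.E a
    · rw [Finsupp.filter_apply_pos _ _ hka] at hk
      exact ⟨hka, ((mem_supp.1 hu) k hk).2⟩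
    · rw [Finsupp.filter_apply_neg _ _ hka] at hk
      exact absurd rfl hk
  have h2 : u.filter (fun k => ¬ k ∈ A.E a) ∈
      Finsupp.supported K K (A.Uw (a.erase v) a ∩ A.L (m + 1)) := by
    rw [mem_supp]
    intro k hk
    by_cases hka : k ∈ A.E a
    · rw [Finsupp.filter_apply_neg (fun k => ¬ k ∈ A.E a) _ (not_not.2 hka)] at hk
      exact absurd rfl hk
    · rw [Finsupp.filter_apply_pos (fun k => ¬ k ∈ A.E a) _ hka] at hk
      obtain ⟨h3, h4⟩ := (mem_supp.1 hu) k hk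
      refine ⟨?_, h4⟩
      rw [A.mem_BB hv]
      rcases h3 with h3 | h3
      · exact Or.inl h3
      · by_cases hko : k = A.o
        · exact Or.inl hko
        · refine Or.inr ⟨h3, fun h => hka ⟨hko, h⟩, fun h => ?_⟩
          have : k ∈ A.E (a.erase v) ∩ A.L (m + 1) := ⟨⟨hko, h⟩, h4⟩
          rw [hne] at this
          exact this
  have h3 : A.D (u.filter (· ∈ A.E a)) = ζ - A.D (u.filter (fun k => ¬ k ∈ A.E a)) := by
    rw [eq_sub_iff_add_eq, ← map_add, hsplit, huD]
  refine ⟨u.filter (· ∈ A.E a), h1, ?_, ?_, ?_⟩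
  · intro h
    rw [h, map_zero] at h3
    exact hnb _ h2 (sub_eq_zero.1 h3.symm).symm
  · intro b hb
    rw [h3]
    exact A.BB_E' hv (sub_mem hζ (A.D_mem (A.her_Uw _ _) h2)) hb
  · intro z' hz' h0
    obtain ⟨c, y, hy, hc⟩ := hgen _ (A.D_E_mem hv hz' h0) (A.DD _)
    refine ⟨c, ?_⟩
    set q := u.filter (· ∈ A.E a) with hq
    set r := u.filter (fun k => ¬ k ∈ A.E a) with hr
    have hB : c • r + y ∈ Finsupp.supported K K (A.Uw (a.erase v) a ∩ A.L (m + 1)) :=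
      add_mem (Submodule.smul_mem _ _ h2) hy
    refine eq_of_E hz' (Submodule.smul_mem _ _ h1) (fun k hk => ?_)
    have h5 := A.cycle_top (a := a) (n := m) (z := z' - c • q - (c • r + y))
      (sub_mem (sub_mem (supp_mono (Set.inter_subset_inter_left _ (A.E_sub_P le_rfl)) hz')
        (supp_mono (Set.inter_subset_inter_left _ (A.E_sub_P le_rfl))
          (Submodule.smul_mem _ _ h1)))
        (supp_mono (Set.inter_subset_inter_left _ (A.BB_sub_P _ _)) hB))
      (by
        rw [map_sub, map_sub, map_add, map_smul, map_smul, h3, hc, smul_sub]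
        abel) hk.1
    rw [Finsupp.sub_apply, Finsupp.sub_apply, A.BB_E hv hB hk.1, sub_zero, sub_eq_zero] at h5
    exact h5

/-- the number of basis elements of degree `a` at level `m` -/
noncomputable def c (m : ℕ) (a : Finset V) : ℕ := (A.E a ∩ A.L m).ncard

lemma fin_EL (m : ℕ) (a : Finset V) : (A.E a ∩ A.L m).Finite :=
  (A.fin m).subset Set.inter_subset_right

lemma finrank_E (m : ℕ) (a : Finset V) :
    Module.finrank K (Finsupp.supported K K (A.E a ∩ A.L m)) = A.c m a ∧
      Module.Finite K (Finsupp.supported K K (A.E a ∩ A.L m)) := by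
  have hf := A.fin_EL m a
  haveI : Fintype ↥(A.E a ∩ A.L m) := hf.fintype
  let e := Finsupp.supportedEquivFinsupp (M := K) (R := K) (A.E a ∩ A.L m)
  constructor
  · rw [e.finrank_eq, Module.finrank_finsupp_self, c, Set.ncard_eq_toFinset_card', Set.toFinset_card]
  · exact Module.Finite.equiv e.symm

lemma rank_null_gen {M N : Type} [AddCommMonoid M] [AddCommMonoid N] [Module K M] [Module K N]
    [Module.Finite K M] (f : M →ₗ[K] N) :
    Module.finrank K (LinearMap.range f) + Module.finrank K (LinearMap.ker f)
      = Module.finrank K M := by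
  letI : AddCommGroup M := Module.addCommMonoidToAddCommGroup K
  letI : AddCommGroup N := Module.addCommMonoidToAddCommGroup K
  exact LinearMap.finrank_range_add_finrank_ker f

lemma finrank_one_gen {M : Type} [AddCommMonoid M] [Module K M] (v : M) (hv : v ≠ 0)
    (h : ∀ w : M, ∃ c : K, c • v = w) : Module.finrank K M = 1 := by
  letI : AddCommGroup M := Module.addCommMonoidToAddCommGroup K
  exact finrank_eq_one v hv h

lemma finrank_le_gen {M : Type} [AddCommMonoid M] [Module K M] [Module.Finite K M]
    (N : Submodule K M) : Module.finrank K N ≤ Module.finrank K M := by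
  letI : AddCommGroup M := Module.addCommMonoidToAddCommGroup K
  exact Submodule.finrank_le N

/-- the component of the differential -/
noncomputable def T (a b : Finset V) (m : ℕ) :
    Finsupp.supported K K (A.E a ∩ A.L (m + 1)) →ₗ[K] Finsupp.supported K K (A.E b ∩ A.L m) := by
  classical
  exact (Finsupp.restrictDom K K (A.E b ∩ A.L m)) ∘ₗ A.D ∘ₗ Submodule.subtype _

lemma T_apply {a b : Finset V} {m : ℕ} (z : Finsupp.supported K K (A.E a ∩ A.L (m + 1))) {k : B}
    (hk : k ∈ A.E b) : (A.T a b m z : B →₀ K) k = A.D z k := by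
  classical
  by_cases hl : k ∈ A.L m
  · have : k ∈ A.E b ∩ A.L m := ⟨hk, hl⟩
    simp [T, Finsupp.restrictDom_apply, hk, hl]
  · have h1 : A.D (z : B →₀ K) k = 0 := by
      by_contra h
      have := A.D_mem (A.her_P a)
        (supp_mono (Set.inter_subset_inter_left _ (A.E_sub_P le_rfl)) z.2)
      exact hl ((mem_supp.1 this) k h).2
    rw [h1]
    by_contra h
    exact hl ((mem_supp.1 (A.T a b m z).2) k h).2

lemma T_eq_zero {a b : Finset V} {m : ℕ} (z : Finsupp.supported K K (A.E a ∩ A.L (m + 1))) :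
    A.T a b m z = 0 ↔ ∀ k ∈ A.E b, A.D z k = 0 := by
  constructor
  · intro h k hk
    rw [← A.T_apply z hk, h]
    rfl
  · intro h
    apply Subtype.ext
    refine eq_of_E (A.T a b m z).2 (zero_mem _) (fun k hk => ?_)
    rw [A.T_apply z hk.1, h k hk.1]
    rfl

lemma T_inj {a : Finset V} {v : V} (hv : v ∈ a) {m : ℕ} (hE : A.Ex (A.Uw (a.erase v) a) m) :
    LinearMap.ker (A.T a (a.erase v) m) = ⊥ := by
  rw [LinearMap.ker_eq_bot']
  intro z hz
  rw [T_eq_zero] at hz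
  exact Subtype.ext (A.inj_aux hv hE z.2 hz)

lemma T_surj {a : Finset V} {v : V} (hv : v ∈ a) {m : ℕ}
    (hE : ∀ n, n + 1 = m → A.Ex (A.Uw (a.erase v) a) n) :
    LinearMap.range (A.T a (a.erase v) m) = ⊤ := by
  rw [LinearMap.range_eq_top]
  intro z
  obtain ⟨u, hu, h⟩ := A.surj_aux hv hE z.2
  refine ⟨⟨u, hu⟩, ?_⟩
  apply Subtype.ext
  refine eq_of_E (A.T a (a.erase v) m ⟨u, hu⟩).2 z.2 (fun k hk => ?_)
  rw [A.T_apply _ hk.1]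
  exact h k hk.1

lemma rank_nullity (a b : Finset V) (m : ℕ) :
    Module.finrank K (LinearMap.range (A.T a b m)) + Module.finrank K (LinearMap.ker (A.T a b m))
      = A.c (m + 1) a := by
  have := (A.finrank_E (m + 1) a).2
  rw [rank_null_gen, (A.finrank_E (m + 1) a).1]

lemma c_le {a : Finset V} {v : V} (hv : v ∈ a) {m : ℕ} (hE : A.Ex (A.Uw (a.erase v) a) m) :
    A.c (m + 1) a ≤ A.c m (a.erase v) := by
  have := (A.finrank_E m (a.erase v)).2
  rw [← A.rank_nullity a (a.erase v) m, A.T_inj hv hE, finrank_bot, add_zero,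
    ← (A.finrank_E m (a.erase v)).1]
  exact finrank_le_gen _

lemma c_eq {a : Finset V} {v : V} (hv : v ∈ a) {m : ℕ}
    (hE : ∀ n, A.Ex (A.Uw (a.erase v) a) n) :
    A.c (m + 1) a = A.c m (a.erase v) := by
  rw [← A.rank_nullity a (a.erase v) m, A.T_inj hv (hE m), finrank_bot, add_zero,
    A.T_surj hv (fun n _ => hE n), finrank_top, (A.finrank_E m (a.erase v)).1]

lemma c_one {a : Finset V} {v : V} (hv : v ∈ a) (hg : A.Good a) {m : ℕ}
    (hE : ∀ n, n + 1 = m → A.Ex (A.Uw (a.erase v) a) n)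
    (hO : A.One (A.Uw (a.erase v) a) m) (hne : A.c (m + 1) (a.erase v) = 0) :
    A.c (m + 1) a = A.c m (a.erase v) + 1 := by
  rw [← A.rank_nullity a (a.erase v) m, A.T_surj hv hE, finrank_top,
    (A.finrank_E m (a.erase v)).1]
  congr 1
  have hne' : A.E (a.erase v) ∩ A.L (m + 1) = ∅ :=
    (Set.ncard_eq_zero (A.fin_EL _ _)).1 hne
  obtain ⟨z, hz, hz0, hzk, hgen⟩ := A.one_aux hv hg hO hne'
  refine finrank_one_gen (⟨⟨z, hz⟩, (A.T_eq_zero _).2 hzk⟩ : LinearMap.ker (A.T a (a.erase v) m))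
    ?_ ?_
  · intro h
    apply hz0
    exact congrArg (fun x : LinearMap.ker (A.T a (a.erase v) m) => x.1.1) h
  · intro x
    obtain ⟨c, hc⟩ := hgen x.1 x.1.2 ((A.T_eq_zero _).1 x.2)
    refine ⟨c, ?_⟩
    apply Subtype.ext
    apply Subtype.ext
    exact hc.symm

lemma c_zero (a : Finset V) : A.c 0 a = 0 := by
  have : A.E a ∩ A.L 0 = ∅ := by
    ext k
    simp only [Set.mem_inter_iff, Set.mem_empty_iff_false, iff_false, not_and]
    intro h1 h2
    have := A.lvl_pos k h1.1
    simp only [L, Set.mem_ofPred_eq] at h2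
    omega
  rw [c, this, Set.ncard_empty]

/-- chain bound -/
lemma lvl_bound (h2 : ∀ a, A.Good a → 2 ≤ a.card) (n : ℕ) :
    ∀ k, k ≠ A.o → A.lvl k = n → n + 1 ≤ (A.dg k).card := by
  induction n using Nat.strong_induction_on with
  | _ n ih =>
    intro k hk hn
    obtain ⟨b, hb⟩ := A.D_single_exists hk
    have h1 := A.D_lvl k b hb
    by_cases hbo : b = A.o
    · subst hbo
      rw [A.lvl_o] at h1
      have := h2 _ (A.good hk)
      omega
    · have h3 := (A.D_dg k b hb).resolve_left hbo
      have h4 := ih (A.lvl b) (by omega) b hbo rfl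
      have := Finset.card_lt_card h3
      omega

end AC

end Boolean
/-! ### The crown -/

section Crown

open Finsupp

namespace AC

variable {K B X Y : Type} [Field K] [DecidableEq X] [DecidableEq Y] [Fintype Y]
  (A : AC K B (Finset (X ⊕ Y))) (e : Y → X)

def com (a : Finset (X ⊕ Y)) : Finset Y :=
  Finset.univ.filter fun j => Sum.inr j ∈ a ∧ Sum.inl (e j) ∈ a

lemma mem_com {a : Finset (X ⊕ Y)} {j : Y} :
    j ∈ com e a ↔ Sum.inr j ∈ a ∧ Sum.inl (e j) ∈ a := by
  simp [com]

lemma crown_count (he : Function.Injective e)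
    (hG : ∀ a, A.Good a ↔ ∃ i j, i ≠ e j ∧ Sum.inl i ∈ a ∧ Sum.inr j ∈ a) (N : ℕ) :
    ∀ a : Finset (X ⊕ Y), a.card = N → (com e a).Nonempty →
      ∀ m, A.c m a = if m + 2 = a.card then (com e a).card - 1 else 0 := by
  induction N with
  | zero =>
    intro a ha ⟨p, hp⟩
    rw [Finset.card_eq_zero] at ha
    simp [ha, mem_com] at hp
  | succ N ih =>
    intro a ha hne m
    obtain ⟨p, hp⟩ := hne
    obtain ⟨hp1, hp2⟩ := (mem_com e).1 hp
    have hcard : ∀ v ∈ a, (a.erase v).card = N := by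
      intro v hv
      rw [Finset.card_erase_of_mem hv, ha]
      rfl
    by_cases hS : ∃ q, q ≠ e p ∧ Sum.inl q ∈ a
    · by_cases hA : ∃ q, Sum.inl q ∈ a ∧ ∀ j, Sum.inr j ∈ a → q ≠ e j
      · -- case A
        obtain ⟨q, hq, hqj⟩ := hA
        have hqp : q ≠ e p := hqj p hp1
        have hex : ∀ n, A.Ex (A.Uw (a.erase (Sum.inl q)) a) n := by
          have h1 : insert (Sum.inl (e p)) ((a.erase (Sum.inl q)).erase (Sum.inl (e p))) =
              a.erase (Sum.inl q) := Finset.insert_erase (by simp [hp2, Ne.symm hqp])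
          rw [← h1]
          refine A.ex_Uw _ _ a ((hG a).2 ⟨q, p, hqp, hq, hp1⟩) (fun c hc hs hgc => ?_)
          obtain ⟨i, j, hij, hi, hj⟩ := (hG c).1 hgc
          have hqc : Sum.inl q ∈ c := hs (by simp [hq])
          exact (hG _).2 ⟨q, j, hqj j (hc hj), by simp [hqc, hqp], by simp [hj]⟩
        have hcom : com e (a.erase (Sum.inl q)) = com e a := by
          ext j
          simp only [mem_com, Finset.mem_erase]
          constructor
          · rintro ⟨h1, h2⟩
            exact ⟨h1.2, h2.2⟩
          · rintro ⟨h1, h2⟩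
            refine ⟨⟨by simp, h1⟩, ?_, h2⟩
            intro h
            exact hqj j h1 (Sum.inl_injective h).symm
        rcases m with _ | m
        · rw [A.c_zero]
          split_ifs with h
          · have h3 : ({Sum.inl (e p), Sum.inl q, Sum.inr p} : Finset (X ⊕ Y)) ⊆ a := by
              intro v hv
              simp only [Finset.mem_insert, Finset.mem_singleton] at hv
              rcases hv with rfl | rfl | rfl <;> assumption
            have h4 := Finset.card_le_card h3
            rw [Finset.card_insert_of_notMem (by simp [Ne.symm hqp]),
              Finset.card_insert_of_notMem (by simp), Finset.card_singleton] at h4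
            omega
          · rfl
        · rw [A.c_eq hq hex, ih _ (hcard _ hq) (by rw [hcom]; exact ⟨p, hp⟩), hcom, hcard _ hq, ha]
          congr 1
          simp only [eq_iff_iff]
          omega
      · -- case B
        push Not at hA
        obtain ⟨q, hqp, hq⟩ := hS
        obtain ⟨r, hr1, rfl⟩ := hA q hq
        have hrp : r ≠ p := fun h => hqp (by rw [h])
        set x : X ⊕ Y := Sum.inl (e p) with hx
        set y : X ⊕ Y := Sum.inr p with hy
        have hxy : y ≠ x := by simp [hx, hy]
        set W := (a.erase x).erase y with hW
        have hxW : x ∉ W := by simp [hW]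
        have hyW : y ∉ W := by simp [hW]
        have hqW : Sum.inl (e r) ∈ W := by simp [hW, hx, hy, hq, hqp]
        have hyW' : insert y W = a.erase x := Finset.insert_erase (by simp [hxy, hp1])
        have haW : insert x (insert y W) = a := by rw [hyW', Finset.insert_erase hp2]
        have hWc : W.card + 2 = a.card := by
          rw [← haW, Finset.card_insert_of_notMem, Finset.card_insert_of_notMem hyW]
          simp [hxW, Ne.symm hxy]
        have hga : A.Good a := (hG a).2 ⟨e p, r, fun h => hrp (he h).symm, hp2, hr1⟩
        have hgy : A.Good (a.erase y) :=
          (hG _).2 ⟨e p, r, fun h => hrp (he h).symm, Finset.mem_erase.2 ⟨Ne.symm hxy, hp2⟩,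
            by simp [hy, hr1, hrp]⟩
        obtain ⟨oneE, oneO⟩ := A.one_Uw x y
          (by
            rw [hG]
            rintro ⟨i, j, hij, hi, hj⟩
            simp only [hx, hy, Finset.mem_insert, Finset.mem_singleton, Sum.inl.injEq,
              Sum.inr.injEq, reduceCtorEq, or_false, false_or] at hi hj
            exact hij (by rw [hi, hj]))
          (by
            intro c hxc hyc u huc hux huy
            rw [hG]
            rcases u with i | j
            · exact ⟨i, p, fun h => hux (by rw [hx, h]), huc, hyc⟩
            · exact ⟨e p, j, fun h => huy (by rw [hy, he h]), hxc, huc⟩)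
          W hxW hyW ⟨_, hqW⟩
        rw [haW] at oneE oneO
        have hIntr : ∀ n, A.Ex (A.Uw W a ∩ A.P (a.erase y)) n := by
          rw [Uw_inter, ← Finset.insert_erase hqW]
          refine A.ex_Uw _ _ _ hgy (fun c hc hs hgc => ?_)
          obtain ⟨i, j, hij, hi, hj⟩ := (hG c).1 hgc
          have hxc : x ∈ c := hs (by simp [hp2, hxW, Ne.symm hxy])
          have hjp : j ≠ p := by
            rintro rfl
            have := hc hj
            simp [hy] at this
          exact (hG _).2 ⟨e p, j, fun h => hjp (he h).symm,
            Finset.mem_erase.2 ⟨fun h => hqp (Sum.inl_injective h).symm, hxc⟩, by simp [hj]⟩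
        have hBE : ∀ n, n + 3 ≠ a.card → A.Ex (A.Uw (a.erase x) a) n := by
          intro n hn
          rw [← hyW', Uw_insert]
          exact A.mv_ex (A.her_Uw _ _) (A.her_P _) (oneE n (by omega)) (A.ex_P hgy n)
            (fun m _ => hIntr m)
        have hBO : ∀ n, n + 3 = a.card → A.One (A.Uw (a.erase x) a) n := by
          intro n hn
          rw [← hyW', Uw_insert]
          exact A.mv_one (A.her_Uw _ _) (A.her_P _) (oneO n (by omega)) (A.ex_P hgy) hIntr
        have hcom : com e (a.erase x) = (com e a).erase p := by
          ext j
          simp only [mem_com, Finset.mem_erase, hx]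
          constructor
          · rintro ⟨h1, h2⟩
            exact ⟨fun h => h2.1 (by rw [h]), h1.2, h2.2⟩
          · rintro ⟨h0, h1, h2⟩
            exact ⟨⟨by simp, h1⟩, fun h => h0 (he (Sum.inl_injective h)), h2⟩
        have hrcom : r ∈ com e (a.erase x) := by
          rw [hcom, Finset.mem_erase, mem_com]
          exact ⟨hrp, hr1, hq⟩
        have ih' := ih _ (hcard _ hp2) ⟨r, hrcom⟩
        have hpos : 0 < (com e (a.erase x)).card := Finset.card_pos.2 ⟨r, hrcom⟩
        have hcc : (com e (a.erase x)).card + 1 = (com e a).card := by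
          rw [hcom, Finset.card_erase_add_one hp]
        have hWpos : 0 < W.card := Finset.card_pos.2 ⟨_, hqW⟩
        rw [hcard _ hp2] at ih'
        rcases m with _ | m
        · rw [A.c_zero, if_neg (by omega)]
        · by_cases hm : m + 3 = a.card
          · rw [A.c_one hp2 hga (fun n hn => hBE n (by omega)) (hBO m hm)
              (by rw [ih', if_neg (by omega)]), ih', if_pos (by omega), if_pos (by omega)]
            omega
          · have h1 := A.c_le hp2 (hBE m hm)
            rw [ih', if_neg (by omega)] at h1
            rw [if_neg (by omega)]
            omega
    · -- only one x
      push Not at hS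
      have hnb := A.no_bad (fun b => (∀ q, Sum.inl q ∈ b → q = e p) ∧ Sum.inr p ∈ b) (by
        rintro b ⟨hb1, hb2⟩ hgb
        refine ⟨b.erase (Sum.inr p), Finset.erase_ssubset hb2, ?_, ?_⟩
        · obtain ⟨i, j, hij, hi, hj⟩ := (hG b).1 hgb
          refine (hG _).2 ⟨i, j, hij, by simp [hi], ?_⟩
          rw [Finset.mem_erase]
          refine ⟨?_, hj⟩
          intro h
          apply hij
          rw [hb1 i hi, Sum.inr_injective h]
        · intro c hc hgc hnc
          rw [le_erase]
          refine ⟨hc, fun hpc => hnc ⟨fun q hq => hb1 q (hc hq), hpc⟩⟩)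
      have hc0 : A.c m a = 0 := by
        have : A.E a ∩ A.L m = ∅ := by
          ext k
          simp only [Set.mem_inter_iff, Set.mem_empty_iff_false, iff_false, not_and]
          intro h1 _
          apply hnb _ k h1.1 rfl
          rw [h1.2]
          refine ⟨fun q hq => ?_, hp1⟩
          by_contra h
          exact hS q h hq
        rw [c, this, Set.ncard_empty]
      have hcom1 : (com e a).card = 1 := by
        rw [Finset.card_eq_one]
        refine ⟨p, ?_⟩
        ext j
        rw [Finset.mem_singleton]
        constructor
        · intro hj
          by_contra h
          exact hS (e j) (fun h' => h (he h')) ((mem_com e).1 hj).2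
        · rintro rfl
          exact hp
      rw [hc0, hcom1]
      simp

end AC

end Crown
/-! ### From minimal free resolutions to abstract complexes -/

section Conv

open Finsupp hiding some

namespace MinFreeRes

variable {K : Type} [Field K] {σ : Type} {I : Ideal (MvPolynomial σ K)} (F : MinFreeRes I)

abbrev Bas : Type := Option (Σ i, Fin (F.rk i))

noncomputable def lam (i : ℕ) (j : Fin (F.rk i)) (k : Fin (F.rk (i + 1))) : K :=
  MvPolynomial.coeff (F.deg (i + 1) k - F.deg i j) (F.d i j k)

noncomputable def mu (j : Fin (F.rk 0)) : K :=
  MvPolynomial.coeff (F.deg 0 j) (F.aug (Pi.single j 1))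

lemma d_eq (i : ℕ) (j : Fin (F.rk i)) (k : Fin (F.rk (i + 1))) :
    F.d i j k = monomial (F.deg (i + 1) k - F.deg i j) (F.lam i j k) := by
  classical
  ext m
  rw [coeff_monomial]
  split_ifs with h
  · rw [← h]; rfl
  · by_contra hm
    apply h
    have := F.d_homog i j k m (by simpa [MvPolynomial.mem_support_iff] using hm)
    rw [← this, add_tsub_cancel_left]

lemma lam_ne {i : ℕ} {j : Fin (F.rk i)} {k : Fin (F.rk (i + 1))} (h : F.lam i j k ≠ 0) :
    F.deg i j < F.deg (i + 1) k := by
  have h1 := F.d_homog i j k _ (by rw [MvPolynomial.mem_support_iff]; exact h)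
  refine lt_of_le_of_ne (h1 ▸ le_self_add) (fun h2 => ?_)
  have := F.minimal i j k
  apply h
  rw [lam, ← h2, tsub_self, this]

lemma aug_eq (j : Fin (F.rk 0)) : F.aug (Pi.single j 1) = monomial (F.deg 0 j) (F.mu j) := by
  classical
  ext m
  rw [coeff_monomial]
  split_ifs with h
  · rw [← h]; rfl
  · by_contra hm
    apply h
    have := F.aug_homog j (show m ∈ _ by simpa [MvPolynomial.mem_support_iff] using hm)
    exact (Finset.mem_singleton.1 this).symm

lemma aug_apply (Y : Fin (F.rk 0) → MvPolynomial σ K) :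
    F.aug Y = ∑ j, monomial (F.deg 0 j) (F.mu j) * Y j := by
  rw [LinearMap.pi_apply_eq_sum_univ F.aug Y]
  refine Finset.sum_congr rfl (fun j _ => ?_)
  rw [← F.aug_eq, smul_eq_mul, mul_comm]
  congr 2
  ext1 i
  simp [Pi.single_apply, eq_comm]

/-- vectors in homological degree `i` -/
noncomputable def emb (i : ℕ) (c : Fin (F.rk i) → K) : F.Bas →₀ K :=
  ∑ j, single (some ⟨i, j⟩) (c j)

lemma emb_same (i : ℕ) (c : Fin (F.rk i) → K) (j : Fin (F.rk i)) :
    F.emb i c (some ⟨i, j⟩) = c j := by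
  classical
  simp [emb, Finsupp.finsetSum_apply, Finsupp.single_apply]

lemma emb_ne {i : ℕ} {c : Fin (F.rk i) → K} {b : F.Bas} (h : F.emb i c b ≠ 0) :
    ∃ j, b = some ⟨i, j⟩ ∧ c j ≠ 0 := by
  classical
  by_contra! hc
  apply h
  rw [emb, Finsupp.finsetSum_apply]
  refine Finset.sum_eq_zero (fun j _ => ?_)
  by_cases hb : b = some ⟨i, j⟩
  · rw [hc j hb]; simp
  · rw [Finsupp.single_apply, if_neg (Ne.symm hb)]

def lev : F.Bas → ℕ
  | none => 0
  | some p => p.1 + 1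

noncomputable def dgr : F.Bas → (σ →₀ ℕ)
  | none => 0
  | some p => F.deg p.1 p.2

noncomputable def bd : F.Bas → (F.Bas →₀ K)
  | none => 0
  | some ⟨0, j⟩ => single none (F.mu j)
  | some ⟨i + 1, k⟩ => F.emb i (fun j => F.lam i j k)

noncomputable def DD : (F.Bas →₀ K) →ₗ[K] (F.Bas →₀ K) := Finsupp.linearCombination K F.bd

lemma DD_single (k : F.Bas) (c : K) : F.DD (single k c) = c • F.bd k := by
  simp [DD]

lemma single_fsum {ι : Type} (S : Finset ι) (b : F.Bas) (f : ι → K) :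
    single b (∑ j ∈ S, f j) = ∑ j ∈ S, single b (f j) :=
  map_sum (Finsupp.singleAddHom b) f S

lemma DD_emb_zero (c : Fin (F.rk 0) → K) :
    F.DD (F.emb 0 c) = single none (∑ j, F.mu j * c j) := by
  rw [emb, map_sum]
  simp only [DD_single, bd, single_fsum, Finsupp.smul_single, smul_eq_mul]
  exact Finset.sum_congr rfl (fun j _ => by rw [mul_comm])

lemma DD_emb_succ (i : ℕ) (c : Fin (F.rk (i + 1)) → K) :
    F.DD (F.emb (i + 1) c) = F.emb i (fun j => ∑ k, F.lam i j k * c k) := by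
  rw [emb, map_sum]
  simp only [DD_single, bd, emb, single_fsum, Finset.smul_sum, Finsupp.smul_single,
    smul_eq_mul]
  rw [Finset.sum_comm]
  exact Finset.sum_congr rfl (fun j _ => Finset.sum_congr rfl (fun k _ => by rw [mul_comm]))

lemma eq_emb {z : F.Bas →₀ K} {i : ℕ} (hz : ∀ k, z k ≠ 0 → F.lev k = i + 1) :
    z = F.emb i (fun j => z (some ⟨i, j⟩)) := by
  ext b
  by_cases hb : ∃ j, b = some ⟨i, j⟩
  · obtain ⟨j, rfl⟩ := hb
    rw [emb_same]
  · have h1 : z b = 0 := by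
      by_contra h
      have := hz b h
      rcases b with _ | ⟨i', j⟩
      · simp [lev] at this
      · simp only [lev, Nat.add_right_cancel_iff] at this
        subst this
        exact hb ⟨j, rfl⟩
    have h2 : F.emb i (fun j => z (some ⟨i, j⟩)) b = 0 := by
      by_contra h
      obtain ⟨j, hj, _⟩ := F.emb_ne h
      exact hb ⟨j, hj⟩
    rw [h1, h2]

lemma eval_mono (m : σ →₀ ℕ) (c : K) :
    MvPolynomial.eval (fun _ => (1 : K)) (monomial m c) = c := by
  simp [MvPolynomial.eval_monomial]

lemma bd_bd (k : F.Bas) : F.DD (F.bd k) = 0 := by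
  rcases k with _ | ⟨i, k⟩
  · simp [bd]
  · rcases i with _ | _ | i
    · simp only [bd, DD_single, smul_zero]
    · simp only [bd]
      rw [DD_emb_zero]
      have h1 : F.aug ((F.d 0).mulVec (Pi.single k 1)) = 0 := by
        rw [← LinearMap.mem_ker, ← F.exact_zero]
        exact ⟨_, rfl⟩
      rw [aug_apply] at h1
      have h2 := congrArg (MvPolynomial.eval (fun _ => (1 : K))) h1
      simp only [map_sum, map_mul, eval_mono, Matrix.mulVec_single_one, Matrix.col_apply, d_eq,
        map_zero] at h2
      rw [h2, Finsupp.single_zero]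
    · simp only [bd]
      rw [DD_emb_succ]
      have h1 : (F.d i).mulVec ((F.d (i + 1)).mulVec (Pi.single k 1)) = 0 := by
        have : (F.d (i + 1)).mulVec (Pi.single k 1) ∈ LinearMap.ker (Matrix.mulVecLin (F.d i)) := by
          rw [← F.exact_succ]
          exact ⟨_, rfl⟩
        exact this
      have h2 : (fun j => ∑ l, F.lam i j l * F.lam (i + 1) l k) = 0 := by
        ext1 j
        have h3 := congrArg (MvPolynomial.eval (fun _ => (1 : K))) (congrFun h1 j)
        simp only [Matrix.mulVec, dotProduct] at h3
        simp only [map_sum, map_mul, d_eq, eval_mono, Pi.zero_apply, map_zero] at h3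
        simpa [Pi.single_apply, apply_ite] using h3
      rw [h2]
      simp [emb]

lemma DD_DD (z : F.Bas →₀ K) : F.DD (F.DD z) = 0 := by
  have : F.DD ∘ₗ F.DD = 0 := by
    apply Finsupp.lhom_ext
    intro k c
    rw [LinearMap.comp_apply, DD_single, map_smul, bd_bd, smul_zero]
    rfl
  exact LinearMap.congr_fun this z

lemma bd_ne {k b : F.Bas} (h : F.bd k b ≠ 0) :
    (∃ j, k = some ⟨0, j⟩ ∧ b = none ∧ F.mu j ≠ 0) ∨
      ∃ i j k', k = some ⟨i + 1, k'⟩ ∧ b = some ⟨i, j⟩ ∧ F.lam i j k' ≠ 0 := by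
  classical
  rcases k with _ | ⟨i, k⟩
  · simp [bd] at h
  · rcases i with _ | i
    · left
      simp only [bd, Finsupp.single_apply] at h
      split_ifs at h with hb
      · exact ⟨k, rfl, hb.symm, h⟩
      · exact absurd rfl h
    · right
      obtain ⟨j, hj, hl⟩ := F.emb_ne h
      exact ⟨i, j, k, rfl, hj, hl⟩

/-- the homogeneous lift of a vector -/
noncomputable def lift (i : ℕ) (a : σ →₀ ℕ) (c : Fin (F.rk i) → K) :
    Fin (F.rk i) → MvPolynomial σ K := fun j => monomial (a - F.deg i j) (c j)

lemma lift_ker_succ (i : ℕ) (a : σ →₀ ℕ) (c : Fin (F.rk (i + 1)) → K)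
    (hc : ∀ k, c k ≠ 0 → F.deg (i + 1) k ≤ a) (h : ∀ j, ∑ k, F.lam i j k * c k = 0) :
    (F.d i).mulVec (F.lift (i + 1) a c) = 0 := by
  ext1 j
  have : ∀ k, F.d i j k * F.lift (i + 1) a c k = monomial (a - F.deg i j) (F.lam i j k * c k) := by
    intro k
    rw [d_eq, lift, monomial_mul]
    by_cases h0 : F.lam i j k * c k = 0
    · rw [h0, map_zero, map_zero]
    · have h1 := (F.lam_ne (left_ne_zero_of_mul h0)).le
      have h2 := hc k (right_ne_zero_of_mul h0)
      congr 1
      rw [add_comm, tsub_add_tsub_cancel h2 h1]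
  simp only [Matrix.mulVec, dotProduct, this]
  rw [← map_sum, h j, map_zero]
  rfl

lemma lift_ker_zero (a : σ →₀ ℕ) (c : Fin (F.rk 0) → K)
    (hc : ∀ k, c k ≠ 0 → F.deg 0 k ≤ a) (h : ∑ k, F.mu k * c k = 0) :
    F.aug (F.lift 0 a c) = 0 := by
  rw [aug_apply]
  have : ∀ k, monomial (F.deg 0 k) (F.mu k) * F.lift 0 a c k = monomial a (F.mu k * c k) := by
    intro k
    rw [lift, monomial_mul]
    by_cases h0 : F.mu k * c k = 0
    · rw [h0, map_zero, map_zero]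
    · have h2 := hc k (right_ne_zero_of_mul h0)
      congr 1
      rw [add_tsub_cancel_of_le h2]
  simp only [this]
  rw [← map_sum, h, map_zero]

open Classical in
/-- the degree `a` part of a polynomial vector -/
noncomputable def part (i : ℕ) (a : σ →₀ ℕ) (Y : Fin (F.rk i) → MvPolynomial σ K) :
    Fin (F.rk i) → K :=
  fun k => if F.deg i k ≤ a then MvPolynomial.coeff (a - F.deg i k) (Y k) else 0

lemma part_ne {i : ℕ} {a : σ →₀ ℕ} {Y : Fin (F.rk i) → MvPolynomial σ K} {k : Fin (F.rk i)}
    (h : F.part i a Y k ≠ 0) : F.deg i k ≤ a := by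
  by_contra hc
  apply h
  rw [part, if_neg hc]

lemma part_succ (i : ℕ) (a : σ →₀ ℕ) (c : Fin (F.rk i) → K)
    (hc : ∀ k, c k ≠ 0 → F.deg i k ≤ a) (Y : Fin (F.rk (i + 1)) → MvPolynomial σ K)
    (h : (F.d i).mulVec Y = F.lift i a c) (j : Fin (F.rk i)) :
    ∑ k, F.lam i j k * F.part (i + 1) a Y k = c j := by
  classical
  by_cases hj : F.deg i j ≤ a
  · have h1 := congrArg (MvPolynomial.coeff (a - F.deg i j)) (congrFun h j)
    simp only [Matrix.mulVec, dotProduct, lift, coeff_monomial, if_true, MvPolynomial.coeff_sum] at h1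
    rw [← h1]
    refine Finset.sum_congr rfl (fun k _ => ?_)
    rw [d_eq, coeff_monomial_mul']
    by_cases h0 : F.lam i j k = 0
    · simp [h0]
    · have h2 := (F.lam_ne h0).le
      by_cases hk : F.deg (i + 1) k ≤ a
      · rw [part, if_pos hk, if_pos (tsub_le_tsub_right hk _), tsub_tsub_tsub_cancel_right h2]
      · rw [part, if_neg hk, if_neg, mul_zero]
        intro h3
        apply hk
        have := add_le_add_left h3 (F.deg i j)
        rwa [tsub_add_cancel_of_le h2, tsub_add_cancel_of_le hj] at this
  · have h1 : c j = 0 := by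
      by_contra h1
      exact hj (hc j h1)
    rw [h1]
    refine Finset.sum_eq_zero (fun k _ => ?_)
    by_contra h0
    exact hj ((F.lam_ne (left_ne_zero_of_mul h0)).le.trans (F.part_ne (right_ne_zero_of_mul h0)))

lemma part_zero (a : σ →₀ ℕ) (c : K) (Y : Fin (F.rk 0) → MvPolynomial σ K)
    (h : F.aug Y = monomial a c) : ∑ k, F.mu k * F.part 0 a Y k = c := by
  classical
  have h1 := congrArg (MvPolynomial.coeff a) h
  rw [aug_apply] at h1
  simp only [coeff_monomial, if_true, MvPolynomial.coeff_sum] at h1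
  rw [← h1]
  refine Finset.sum_congr rfl (fun k _ => ?_)
  rw [coeff_monomial_mul', part]
  split_ifs <;> simp

lemma emb_mem (i : ℕ) (a : σ →₀ ℕ) (c : Fin (F.rk i) → K) (hc : ∀ k, c k ≠ 0 → F.deg i k ≤ a) :
    F.emb i c ∈ Finsupp.supported K K ({k | k = none ∨ F.dgr k ≤ a} ∩ {k | F.lev k = i + 1}) := by
  rw [AC.mem_supp]
  intro b hb
  obtain ⟨j, rfl, hj⟩ := F.emb_ne hb
  exact ⟨Or.inr (hc j hj), rfl⟩

noncomputable def toAC : AC K F.Bas (σ →₀ ℕ) where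
  o := none
  lvl := F.lev
  dg := F.dgr
  Good a := monomial a (1 : K) ∈ I
  D := F.DD
  lvl_o := rfl
  lvl_pos k hk := by
    rcases k with _ | ⟨i, k⟩
    · exact absurd rfl hk
    · simp [lev]
  fin n := by
    rcases n with _ | n
    · refine (Set.finite_singleton none).subset ?_
      intro k hk
      rcases k with _ | ⟨i, k⟩
      · rfl
      · simp [lev] at hk
    · refine (Set.finite_range (fun j : Fin (F.rk n) => (some ⟨n, j⟩ : F.Bas))).subset ?_
      intro k hk
      rcases k with _ | ⟨i, k⟩
      · simp [lev] at hk
      · simp only [lev, Set.mem_ofPred_eq, Nat.add_right_cancel_iff] at hk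
        subst hk
        exact ⟨k, rfl⟩
  DD := F.DD_DD
  D_lvl k b h := by
    rw [DD_single, one_smul] at h
    rcases F.bd_ne h with ⟨j, rfl, rfl, _⟩ | ⟨i, j, k', rfl, rfl, _⟩
    · rfl
    · rfl
  D_dg k b h := by
    rw [DD_single, one_smul] at h
    rcases F.bd_ne h with ⟨j, rfl, rfl, _⟩ | ⟨i, j, k', rfl, rfl, hl⟩
    · exact Or.inl rfl
    · exact Or.inr (F.lam_ne hl)
  good_mono a b hab h := by
    have : monomial b (1 : K) = monomial (b - a) 1 * monomial a 1 := by
      rw [monomial_mul, tsub_add_cancel_of_le hab, one_mul]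
    rw [this]
    exact Ideal.mul_mem_left _ _ h
  good_of k h := by
    rw [DD_single, one_smul] at h
    rcases F.bd_ne h with ⟨j, rfl, _, hl⟩ | ⟨i, j, k', rfl, h2, hl⟩
    · have h1 : monomial (F.deg 0 j) (F.mu j) ∈ I := by
        rw [← F.aug_eq, ← F.range_aug]
        exact ⟨_, rfl⟩
      have h2 : monomial (F.deg 0 j) (1 : K) = C (F.mu j)⁻¹ * monomial (F.deg 0 j) (F.mu j) := by
        rw [C_mul_monomial, inv_mul_cancel₀ hl]
      change monomial (F.deg 0 j) (1 : K) ∈ I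
      rw [h2]
      exact Ideal.mul_mem_left _ _ h1
    · exact absurd h2 (by simp)
  ex_pos a n := by
    intro z hz hD
    rw [AC.mem_supp] at hz
    have hz1 := F.eq_emb (fun k hk => (hz k hk).2)
    set c : Fin (F.rk n) → K := fun j => z (some ⟨n, j⟩) with hc
    have hca : ∀ k, c k ≠ 0 → F.deg n k ≤ a := by
      intro k hk
      rcases (hz _ hk).1 with h | h
      · exact absurd h (by simp)
      · exact h
    rw [hz1] at hD ⊢
    have hY : ∃ Y, (F.d n).mulVec Y = F.lift n a c := by
      rcases n with _ | i
      · rw [DD_emb_zero, Finsupp.single_eq_zero] at hD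
        have h1 := F.lift_ker_zero a c hca hD
        rw [← LinearMap.mem_ker, ← F.exact_zero] at h1
        exact h1
      · rw [DD_emb_succ] at hD
        have h1 := F.lift_ker_succ i a c hca (fun j => by
          have := DFunLike.congr_fun hD (some ⟨i, j⟩)
          rwa [emb_same] at this)
        have h2 : F.lift (i + 1) a c ∈ LinearMap.ker (Matrix.mulVecLin (F.d i)) := h1
        rw [← F.exact_succ] at h2
        exact h2
    obtain ⟨Y, hY⟩ := hY
    refine ⟨F.emb (n + 1) (F.part (n + 1) a Y), F.emb_mem _ _ _ (fun k hk => F.part_ne hk), ?_⟩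
    rw [DD_emb_succ]
    congr 1
    ext1 j
    exact F.part_succ n a c hca Y hY j
  ex_zero a ha := by
    intro z hz _
    rw [AC.mem_supp] at hz
    have hm : monomial a (z none) ∈ I := by
      have h2 : monomial a (z none) = C (z none) * monomial a (1 : K) := by
        rw [C_mul_monomial, mul_one]
      rw [h2]
      exact Ideal.mul_mem_left _ _ ha
    rw [← F.range_aug] at hm
    obtain ⟨Y, hY⟩ := hm
    refine ⟨F.emb 0 (F.part 0 a Y), F.emb_mem _ _ _ (fun k hk => F.part_ne hk), ?_⟩
    rw [DD_emb_zero, F.part_zero a _ Y hY]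
    ext b
    rcases b with _ | ⟨i, k⟩
    · simp
    · have : z (some ⟨i, k⟩) = 0 := by
        by_contra h
        have := (hz _ h).2
        simp [lev] at this
      simp [this]

end MinFreeRes

end Conv
/-! ### Polarised degrees -/

section Pol

namespace AC

variable {K B σ : Type} [Field K] [Fintype σ] [DecidableEq σ]

/-- the set of coordinates where `a` reaches the threshold -/
def st (Θ a : σ →₀ ℕ) : Finset σ := Finset.univ.filter (fun u => Θ u ≤ a u)

lemma mem_st {Θ a : σ →₀ ℕ} {u : σ} : u ∈ st Θ a ↔ Θ u ≤ a u := by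
  simp [st]

/-- the threshold degree restricted to a set -/
noncomputable def rs (Θ : σ →₀ ℕ) (a : Finset σ) : σ →₀ ℕ :=
  Finsupp.equivFunOnFinite.symm (fun u => if u ∈ a then Θ u else 0)

lemma rs_apply (Θ : σ →₀ ℕ) (a : Finset σ) (u : σ) : rs Θ a u = if u ∈ a then Θ u else 0 := rfl

lemma st_rs {Θ : σ →₀ ℕ} (hΘ : ∀ u, 1 ≤ Θ u) (a : Finset σ) : st Θ (rs Θ a) = a := by
  ext u
  rw [mem_st, rs_apply]
  have := hΘ u
  split_ifs with h
  · simp [h]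
  · simp only [h, iff_false]; omega

variable (A : AC K B (σ →₀ ℕ)) {Θ : σ →₀ ℕ} (hΘ : ∀ u, 1 ≤ Θ u) {G : Finset σ → Prop}
  (hG : ∀ a, A.Good a ↔ G (st Θ a))

lemma lattice (hG : ∀ a, A.Good a ↔ G (st Θ a))
    (k : B) (hk : k ≠ A.o) (u : σ) : A.dg k u = 0 ∨ A.dg k u = Θ u := by
  have := A.no_bad (fun b => ∃ u, b u ≠ 0 ∧ b u ≠ Θ u) (by
    rintro b ⟨u, h0, h1⟩ hb
    have hap : ∀ v, (b - Finsupp.single u 1 : σ →₀ ℕ) v = if v = u then b v - 1 else b v := by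
      intro v
      rw [Finsupp.tsub_apply, Finsupp.single_apply]
      by_cases h : v = u
      · simp [h]
      · rw [if_neg (Ne.symm h), if_neg h, Nat.sub_zero]
    refine ⟨b - Finsupp.single u 1, ?_, ?_, ?_⟩
    · refine lt_of_le_of_ne tsub_le_self (fun h => ?_)
      have := hap u
      rw [h, if_pos rfl] at this
      omega
    · rw [hG] at hb ⊢
      have : st Θ (b - Finsupp.single u 1) = st Θ b := by
        ext v
        rw [mem_st, mem_st, hap]
        split_ifs with h
        · subst h; omega
        · rfl
      rwa [this]
    · intro c hc _ hnb v
      rw [hap]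
      have h2 := hc v
      split_ifs with h
      · subst h
        by_contra h3
        exact hnb ⟨v, by omega, by omega⟩
      · exact h2) _ k hk rfl
  by_contra hc
  push Not at hc
  exact this ⟨u, hc⟩

lemma dg_eq_rs (hΘ : ∀ u, 1 ≤ Θ u) (hG : ∀ a, A.Good a ↔ G (st Θ a))
    (k : B) (hk : k ≠ A.o) : A.dg k = rs Θ (st Θ (A.dg k)) := by
  ext u
  rw [rs_apply]
  have h1 := A.lattice hG k hk u
  have h2 := hΘ u
  split_ifs with h
  · rw [mem_st] at h; omega
  · rw [mem_st] at h; omega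

lemma P_eq (hΘ : ∀ u, 1 ≤ Θ u) (hG : ∀ a, A.Good a ↔ G (st Θ a))
    (a : Finset σ) :
    {k | k = A.o ∨ st Θ (A.dg k) ≤ a} = {k | k = A.o ∨ A.dg k ≤ rs Θ a} := by
  ext k
  simp only [Set.mem_ofPred_eq]
  by_cases hk : k = A.o
  · simp [hk]
  simp only [hk, false_or]
  constructor
  · intro h u
    rw [rs_apply]
    have h1 := A.lattice hG k hk u
    split_ifs with h2
    · omega
    · have : u ∉ st Θ (A.dg k) := fun h3 => h2 (h h3)
      rw [mem_st] at this
      omega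
  · intro h u hu
    rw [mem_st] at hu
    have h1 := h u
    rw [rs_apply] at h1
    have := hΘ u
    by_contra h2
    rw [if_neg h2] at h1
    omega

lemma good_rs (hΘ : ∀ u, 1 ≤ Θ u) (hG : ∀ a, A.Good a ↔ G (st Θ a))
    (a : Finset σ) : G a ↔ A.Good (rs Θ a) := by
  rw [hG, st_rs hΘ]

/-- the complex regarded as graded by finite sets -/
def pol : AC K B (Finset σ) where
  o := A.o
  lvl := A.lvl
  dg k := st Θ (A.dg k)
  Good := G
  D := A.D
  lvl_o := A.lvl_o
  lvl_pos := A.lvl_pos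
  fin := A.fin
  DD := A.DD
  D_lvl := A.D_lvl
  D_dg k b h := by
    rcases A.D_dg k b h with h1 | h1
    · exact Or.inl h1
    by_cases hb : b = A.o
    · exact Or.inl hb
    refine Or.inr (lt_of_le_of_ne ?_ ?_)
    · intro u hu
      rw [mem_st] at hu ⊢
      exact hu.trans (h1.le u)
    · intro h2
      have hk : k ≠ A.o := by
        rintro rfl
        have := A.D_lvl _ _ h
        rw [A.lvl_o] at this
        omega
      have h3 := A.dg_eq_rs hΘ hG k hk
      have h4 := A.dg_eq_rs hΘ hG b hb
      rw [h2, ← h3] at h4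
      exact h1.ne h4
  good_mono a b hab h := by
    rw [A.good_rs hΘ hG] at h ⊢
    refine A.good_mono _ _ ?_ h
    intro u
    rw [rs_apply, rs_apply]
    split_ifs with h1 h2
    · exact le_rfl
    · exact absurd (hab h1) h2
    · exact Nat.zero_le _
    · exact le_rfl
  good_of k h := (hG _).1 (A.good_of k h)
  ex_pos a n := by
    rw [A.P_eq hΘ hG]
    exact A.ex_pos _ n
  ex_zero a ha := by
    rw [A.P_eq hΘ hG]
    exact A.ex_zero _ ((A.good_rs hΘ hG a).1 ha)

end AC

end Pol

section Crown

variable {K : Type} [Field K] {s t : ℕ}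

lemma crown_mem (w : Fin t → ℕ) (a : (Fin s ⊕ Fin t) →₀ ℕ) :
    monomial a (1 : K) ∈ Ideal.span {p : MvPolynomial (Fin s ⊕ Fin t) K |
      ∃ (i : Fin s) (j : Fin t), (i : ℕ) ≠ (j : ℕ) ∧
      p = X (Sum.inl i) * X (Sum.inr j) ^ w j} ↔
    ∃ (i : Fin s) (j : Fin t), (i : ℕ) ≠ (j : ℕ) ∧ 1 ≤ a (Sum.inl i) ∧ w j ≤ a (Sum.inr j) := by
  classical
  have h1 : {p : MvPolynomial (Fin s ⊕ Fin t) K |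
      ∃ (i : Fin s) (j : Fin t), (i : ℕ) ≠ (j : ℕ) ∧
      p = X (Sum.inl i) * X (Sum.inr j) ^ w j} =
      (fun m => monomial m (1 : K)) '' {m | ∃ (i : Fin s) (j : Fin t), (i : ℕ) ≠ (j : ℕ) ∧
        m = Finsupp.single (Sum.inl i) 1 + Finsupp.single (Sum.inr j) (w j)} := by
    have h2 : ∀ (i : Fin s) (j : Fin t), (X (Sum.inl i) * X (Sum.inr j) ^ w j :
        MvPolynomial (Fin s ⊕ Fin t) K) =
        monomial (Finsupp.single (Sum.inl i) 1 + Finsupp.single (Sum.inr j) (w j)) 1 := by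
      intro i j
      rw [X_pow_eq_monomial, X, monomial_mul, one_mul]
    ext p
    constructor
    · rintro ⟨i, j, hij, rfl⟩
      exact ⟨_, ⟨i, j, hij, rfl⟩, (h2 i j).symm⟩
    · rintro ⟨_, ⟨i, j, hij, rfl⟩, rfl⟩
      exact ⟨i, j, hij, (h2 i j).symm⟩
  rw [h1, mem_ideal_span_monomial_image]
  have h3 : (monomial a (1 : K)).support = {a} := by
    rw [support_monomial, if_neg one_ne_zero]
  rw [h3]
  simp only [Finset.mem_singleton, forall_eq]
  constructor
  · rintro ⟨_, ⟨i, j, hij, rfl⟩, h⟩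
    refine ⟨i, j, hij, ?_, ?_⟩
    · simpa using h (Sum.inl i)
    · simpa using h (Sum.inr j)
  · rintro ⟨i, j, hij, hi, hj⟩
    refine ⟨_, ⟨i, j, hij, rfl⟩, ?_⟩
    rintro (u | u)
    · by_cases h : i = u
      · subst h; simpa using hi
      · simp [h]
    · by_cases h : j = u
      · subst h; simpa using hj
      · simp [h]

end Crown
lemma AC.com_empty_card {X Y : Type} [Fintype X] [Fintype Y] [DecidableEq X] [DecidableEq Y]
    (e : Y → X) (he : Function.Injective e) (a : Finset (X ⊕ Y))
    (h : ¬ (AC.com e a).Nonempty) : a.card ≤ Fintype.card X := by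
  rw [← Finset.card_univ]
  refine Finset.card_le_card_of_injOn (Sum.elim id e) (fun _ _ => Finset.mem_coe.2 (Finset.mem_univ _)) ?_
  rintro (x | x) hx (y | y) hy hxy
  · exact congrArg Sum.inl hxy
  · exfalso
    have hxy' : x = e y := hxy
    subst hxy'
    exact h ⟨y, (AC.mem_com e).2 ⟨hy, hx⟩⟩
  · exfalso
    have hxy' : e x = y := hxy
    subst hxy'
    exact h ⟨x, (AC.mem_com e).2 ⟨hx, hy⟩⟩
  · exact congrArg Sum.inr (he hxy)

/-- For `1 < t < s`, the edge ideal `I_{s,t} = (x_i y_j^{w_j} : i ≠ j)` of the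
weighted oriented unbalanced crown graph has `pdim = s + t - 3`, and its top
multigraded Betti number is `t - 1` at `α = x_1⋯x_s·y_1^{w_1}⋯y_t^{w_t}` and `0`
otherwise. -/
theorem stmt16 {K : Type} [Field K] (s t : ℕ) (ht : 1 < t) (hts : t < s)
    (w : Fin t → ℕ) (hw : ∀ j, 1 ≤ w j)
    (I : Ideal (MvPolynomial (Fin s ⊕ Fin t) K))
    (hI : I = Ideal.span {p | ∃ (i : Fin s) (j : Fin t), (i : ℕ) ≠ (j : ℕ) ∧
      p = X (Sum.inl i) * X (Sum.inr j) ^ w j})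
    (Θ : (Fin s ⊕ Fin t) →₀ ℕ)
    (hΘ : Θ = Finsupp.equivFunOnFinite.symm (Sum.elim (fun _ => 1) w))
    (F : MinFreeRes I) :
    F.IsPdim (s + t - 3) ∧ ∀ a, F.cnt (s + t - 3) a = if a = Θ then t - 1 else 0 := by
  classical
  let e : Fin t → Fin s := Fin.castLE hts.le
  have he : Function.Injective e := Fin.castLE_injective hts.le
  have hne : ∀ (i : Fin s) (j : Fin t), (i : ℕ) ≠ (j : ℕ) ↔ i ≠ e j := by
    intro i j
    rw [Ne, Ne, Fin.ext_iff]
    rfl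
  have hΘl : ∀ i, Θ (Sum.inl i) = 1 := by
    intro i
    rw [hΘ]
    rfl
  have hΘr : ∀ j, Θ (Sum.inr j) = w j := by
    intro j
    rw [hΘ]
    rfl
  have hΘ1 : ∀ u, 1 ≤ Θ u := by
    rintro (u | u)
    · rw [hΘl]
    · rw [hΘr]; exact hw u
  let G : Finset (Fin s ⊕ Fin t) → Prop :=
    fun a => ∃ i j, i ≠ e j ∧ Sum.inl i ∈ a ∧ Sum.inr j ∈ a
  have hG : ∀ a, F.toAC.Good a ↔ G (AC.st Θ a) := by
    intro a
    change monomial a (1 : K) ∈ I ↔ _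
    rw [hI, crown_mem]
    simp only [G, AC.mem_st, hne, hΘl, hΘr]
  let A := F.toAC.pol hΘ1 hG
  have hAG : ∀ a, A.Good a ↔ ∃ i j, i ≠ e j ∧ Sum.inl i ∈ a ∧ Sum.inr j ∈ a := fun a => Iff.rfl
  have h2 : ∀ a, A.Good a → 2 ≤ a.card := by
    rintro a ⟨i, j, _, hi, hj⟩
    have : ({Sum.inl i, Sum.inr j} : Finset (Fin s ⊕ Fin t)) ⊆ a := by
      intro u hu
      rcases Finset.mem_insert.1 hu with rfl | hu
      · exact hi
      · rw [Finset.mem_singleton.1 hu]; exact hj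
    have h3 := Finset.card_le_card this
    rwa [Finset.card_pair (by simp)] at h3
  have hcu : (Finset.univ : Finset (Fin s ⊕ Fin t)).card = s + t := by
    simp
  have hkey : ∀ i (j : Fin (F.rk i)), i ≤ s + t - 3 ∧
      (i = s + t - 3 → AC.st Θ (F.deg i j) = Finset.univ) := by
    intro i j
    set a := AC.st Θ (F.deg i j) with ha
    let k : F.Bas := Option.some ⟨i, j⟩
    have hk : k ≠ A.o := by
      intro h
      exact Option.some_ne_none _ h
    have hdg : A.dg k = a := rfl
    have hlv : A.lvl k = i + 1 := rfl
    have hle : a.card ≤ s + t := hcu ▸ Finset.card_le_univ a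
    by_cases hc : (AC.com e a).Nonempty
    · have h3 := A.crown_count e he hAG _ a rfl hc (i + 1)
      have h4 : A.c (i + 1) a ≠ 0 := by
        rw [AC.c]
        intro h5
        rw [Set.ncard_eq_zero (A.fin_EL _ _)] at h5
        have : k ∈ A.E a ∩ A.L (i + 1) := ⟨⟨hk, hdg⟩, hlv⟩
        rw [h5] at this
        exact this
      have h5 : i + 1 + 2 = a.card := by
        by_contra h5
        rw [if_neg h5] at h3
        exact h4 h3
      refine ⟨by omega, fun hi => ?_⟩
      rw [← Finset.card_eq_iff_eq_univ, Fintype.card_sum, Fintype.card_fin, Fintype.card_fin]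
      omega
    · have h3 := AC.com_empty_card e he a hc
      rw [Fintype.card_fin] at h3
      have h4 := A.lvl_bound h2 (i + 1) k hk hlv
      rw [hdg] at h4
      exact ⟨by omega, fun hi => by omega⟩
  have hdeg : ∀ i (j : Fin (F.rk i)), AC.st Θ (F.deg i j) = Finset.univ ↔ F.deg i j = Θ := by
    intro i j
    constructor
    · intro h
      have h1 : F.deg i j = AC.rs Θ (AC.st Θ (F.deg i j)) :=
        F.toAC.dg_eq_rs hΘ1 hG (Option.some ⟨i, j⟩) (by
          intro h
          exact Option.some_ne_none _ h)
      rw [h1, h]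
      ext u
      rw [AC.rs_apply, if_pos (Finset.mem_univ u)]
    · intro h
      rw [h]
      ext u
      simp [AC.mem_st]
  have hcnt : F.cnt (s + t - 3) Θ = t - 1 := by
    have hcom : AC.com e (Finset.univ : Finset (Fin s ⊕ Fin t)) = Finset.univ := by
      ext j
      simp [AC.mem_com]
    have h3 := A.crown_count e he hAG _ Finset.univ rfl
      (by rw [hcom]; exact ⟨⟨0, by omega⟩, Finset.mem_univ _⟩) (s + t - 3 + 1)
    rw [if_pos (by rw [hcu]; omega), hcom, Finset.card_univ, Fintype.card_fin] at h3
    rw [← h3, AC.c, MinFreeRes.cnt, ← Nat.card_coe_set_eq]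
    refine Nat.card_congr (Equiv.ofBijective
      (fun j => ⟨Option.some ⟨s + t - 3, j.1⟩, ⟨fun h => Option.some_ne_none _ h,
        (hdeg _ _).2 j.2⟩, rfl⟩) ⟨?_, ?_⟩)
    · rintro ⟨j, hj⟩ ⟨j', hj'⟩ h
      have h := congrArg Subtype.val h
      simpa using h
    · rintro ⟨k, ⟨hk, hk1⟩, hk2⟩
      rcases k with _ | ⟨i, j⟩
      · exact absurd rfl hk
      · have hi : i + 1 = s + t - 3 + 1 := hk2
        obtain rfl : i = s + t - 3 := by omega
        exact ⟨⟨j, (hdeg _ _).1 hk1⟩, rfl⟩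
  refine ⟨⟨?_, ?_⟩, ?_⟩
  · intro h0
    have : IsEmpty (Fin (F.rk (s + t - 3))) := by
      rw [h0]
      infer_instance
    have h1 : F.cnt (s + t - 3) Θ = 0 := by
      rw [MinFreeRes.cnt]
      exact Nat.card_of_isEmpty
    omega
  · intro i hi
    by_contra h0
    have := (hkey i ⟨0, Nat.pos_of_ne_zero h0⟩).1
    omega
  · intro a
    split_ifs with h
    · rw [h, hcnt]
    · have : IsEmpty {j : Fin (F.rk (s + t - 3)) // F.deg (s + t - 3) j = a} := by
        refine ⟨fun j => h ?_⟩
        rw [← j.2]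
        exact (hdeg _ _).1 ((hkey _ j.1).2 rfl)
      rw [MinFreeRes.cnt]
      exact Nat.card_of_isEmpty
end

section
/- Let I_n be the edge ideal of the weighted oriented crown graph G_n with n ≥ 2. Then for every i ≥ 0, the i-th total Betti number satisfies β_i(I_n) = Σ_{k=2}^{n} (k−1)·2^(i+3−2k)·C(n,k)·C(n−k, i+3−2k) + (2^(i+2) − 2)·C(n, i+2). In particular, β_i(I_n) does not depend on the weights w_1,...,w_n. -/
open MvPolynomial

namespace CrownBetti
open CategoryTheory CategoryTheory.Abelian

section layer1
variable {R : Type} [CommRing R]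

/-- Ext groups of concrete modules. -/
abbrev EE (R : Type) [CommRing R] (k : Type) [AddCommGroup k] [Module R k] (M : Type)
    [AddCommGroup M] [Module R M] (i : ℕ) : Type :=
  Ext (ModuleCat.of R M) (ModuleCat.of R k) i

variable (k : Type) [AddCommGroup k] [Module R k]
variable {M N L : Type} [AddCommGroup M] [Module R M] [AddCommGroup N] [Module R N]
  [AddCommGroup L] [Module R L]

/-- Pullback of Ext classes. -/
noncomputable def pb (f : M →ₗ[R] N) (i : ℕ) : EE R k N i →ₗ[R] EE R k M i where
  toFun α := (Ext.mk₀ (ModuleCat.ofHom f)).comp α (zero_add i)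
  map_add' _ _ := Ext.comp_add _ _ _ _
  map_smul' _ _ := Ext.comp_smul _ _ _ _

lemma pb_comp (f : M →ₗ[R] N) (g : N →ₗ[R] L) (i : ℕ) (α : EE R k L i) :
    pb k f i (pb k g i α) = pb k (g ∘ₗ f) i α := by
  simp [pb, ModuleCat.ofHom_comp]

lemma pb_id (i : ℕ) (α : EE R k M i) : pb k (LinearMap.id : M →ₗ[R] M) i α = α := by
  simp [pb]

lemma pb_zero (i : ℕ) (α : EE R k N i) : pb k (0 : M →ₗ[R] N) i α = 0 := by
  have : ModuleCat.ofHom (0 : M →ₗ[R] N) = 0 := rfl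
  simp [pb, this]

lemma pb_add (f g : M →ₗ[R] N) (i : ℕ) (α : EE R k N i) :
    pb k (f + g) i α = pb k f i α + pb k g i α := by
  have : ModuleCat.ofHom (f + g) = ModuleCat.ofHom f + ModuleCat.ofHom g := rfl
  simp [pb, this, Ext.mk₀_add]

lemma pb_smul (r : R) (f : M →ₗ[R] N) (i : ℕ) (α : EE R k N i) :
    pb k (r • f) i α = r • pb k f i α := by
  have : ModuleCat.ofHom (r • f) = r • ModuleCat.ofHom f := rfl
  simp [pb, this, Ext.mk₀_smul]

lemma smul_eq_zero_of_kill (r : R) (hr : ∀ x : k, r • x = 0) (i : ℕ) (α : EE R k M i) :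
    r • α = 0 := by
  rw [Ext.smul_eq_comp_mk₀]
  have : r • 𝟙 (ModuleCat.of R k) = 0 := by
    ext x; exact hr x
  rw [this]; simp

variable {A B C : Type} [AddCommGroup A] [Module R A] [AddCommGroup B] [Module R B]
  [AddCommGroup C] [Module R C]

lemma shortExact (f : A →ₗ[R] B) (g : B →ₗ[R] C) (hf : Function.Injective f)
    (hfg : Function.Exact f g) (hg : Function.Surjective g) :
    (ShortComplex.mk (ModuleCat.ofHom f) (ModuleCat.ofHom g)
      (by rw [← ModuleCat.ofHom_comp, hfg.linearMap_comp_eq_zero]; rfl)).ShortExact where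
  exact := by
    rw [ShortComplex.ShortExact.moduleCat_exact_iff_function_exact]
    exact hfg
  mono_f := by
    rw [ModuleCat.mono_iff_injective]; exact hf
  epi_g := by
    rw [ModuleCat.epi_iff_surjective]; exact hg

lemma les2 (f : A →ₗ[R] B) (g : B →ₗ[R] C) (hf : Function.Injective f)
    (hfg : Function.Exact f g) (hg : Function.Surjective g) (i : ℕ) :
    Function.Exact (pb k g i) (pb k f i) := by
  intro α
  constructor
  · intro h
    exact Ext.contravariant_sequence_exact₂ (shortExact f g hf hfg hg) _ α h
  · rintro ⟨β, rfl⟩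
    rw [pb_comp, hfg.linearMap_comp_eq_zero, pb_zero]

lemma les13 (f : A →ₗ[R] B) (g : B →ₗ[R] C) (hf : Function.Injective f)
    (hfg : Function.Exact f g) (hg : Function.Surjective g) (i : ℕ) :
    ∃ δ : EE R k A i →ₗ[R] EE R k C (i + 1), Function.Exact (pb k f i) δ ∧
      Function.Exact δ (pb k g (i + 1)) := by
  have hS := shortExact f g hf hfg hg
  refine ⟨{ toFun := fun α => hS.extClass.comp α (add_comm 1 i)
            map_add' := fun a b => Ext.comp_add _ _ _ _
            map_smul' := fun r a => Ext.comp_smul _ _ _ _ }, ?_, ?_⟩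
  · intro α
    constructor
    · intro h
      exact Ext.contravariant_sequence_exact₁ hS _ α (add_comm 1 i) h
    · rintro ⟨β, rfl⟩
      exact hS.extClass_comp_assoc (h := add_comm 1 i) β
  · intro α
    constructor
    · intro h
      exact Ext.contravariant_sequence_exact₃ hS _ α h (add_comm 1 i)
    · rintro ⟨β, rfl⟩
      exact hS.comp_extClass_assoc β (add_comm 1 i)

lemma pb_inj0 (g : B →ₗ[R] C) (hg : Function.Surjective g) : Function.Injective (pb k g 0) := by
  have : Epi (ModuleCat.ofHom g) := by
    rw [ModuleCat.epi_iff_surjective]; exact hg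
  exact Ext.precomp_mk₀_injective_of_epi _ (ModuleCat.ofHom g)

/-- The (Ext) Betti numbers. -/
noncomputable def bt (M : Type) [AddCommGroup M] [Module R M] (i : ℕ) : ℕ∞ :=
  Module.length R (EE R k M i)

lemma bt_ses (f : A →ₗ[R] B) (g : B →ₗ[R] C) (hf : Function.Injective f)
    (hfg : Function.Exact f g) (hg : Function.Surjective g)
    (hz : ∀ i α, pb k f i α = 0) :
    bt (R := R) k C 0 = bt (R := R) k B 0 ∧
      ∀ i, bt (R := R) k C (i + 1) = bt (R := R) k B (i + 1) + bt (R := R) k A i := by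
  have hsurj : ∀ i, Function.Surjective (pb k g i) := fun i α =>
    (les2 k f g hf hfg hg i α).1 (hz i α)
  constructor
  · exact (LinearEquiv.ofBijective (pb k g 0) ⟨pb_inj0 k g hg, hsurj 0⟩).length_eq
  · intro i
    obtain ⟨δ, h1, h2⟩ := les13 k f g hf hfg hg i
    have hδ : Function.Injective δ := by
      rw [injective_iff_map_eq_zero]
      intro a ha
      obtain ⟨b, rfl⟩ := (h1 a).1 ha
      exact hz i b
    have := Module.length_eq_add_of_exact δ (pb k g (i + 1)) hδ (hsurj _) h2
    rw [bt, this, add_comm]; rfl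

lemma bt_prod (i : ℕ) : bt (R := R) k (A × B) i = bt (R := R) k A i + bt (R := R) k B i := by
  have hs : Function.Surjective (pb k (LinearMap.inl R A B) i) := fun α =>
    ⟨pb k (LinearMap.fst R A B) i α, by rw [pb_comp, LinearMap.fst_comp_inl, pb_id]⟩
  have hi : Function.Injective (pb k (LinearMap.snd R A B) i) := by
    apply Function.LeftInverse.injective (g := pb k (LinearMap.inr R A B) i)
    intro α
    rw [pb_comp, LinearMap.snd_comp_inr, pb_id]
  have := Module.length_eq_add_of_exact _ _ hi hs
    (les2 k (LinearMap.inl R A B) (LinearMap.snd R A B) LinearMap.inl_injective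
      Function.Exact.inl_snd LinearMap.snd_surjective i)
  rw [bt, this, add_comm]; rfl

lemma EE_free_zero [Module.Projective R M] (i : ℕ) (α : EE R k M (i + 1)) : α = 0 := by
  have : Projective (ModuleCat.of R M) := (IsProjective.iff_projective M).1 inferInstance
  exact Ext.eq_zero_of_projective α

lemma EE_subsingleton [Subsingleton M] (i : ℕ) (α : EE R k M i) : α = 0 := by
  rw [← pb_id k i α, show (LinearMap.id : M →ₗ[R] M) = 0 from Subsingleton.elim _ _, pb_zero]

/-- Ext in degree zero. -/
noncomputable def EE0 : EE R k M 0 ≃ₗ[R] (M →ₗ[R] k) :=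
  (Ext.linearEquiv₀ (R := R)).trans (ModuleCat.homLinearEquiv (S := R))

lemma EE0_pb (f : M →ₗ[R] N) (α : EE R k N 0) : EE0 k (pb k f 0 α) = EE0 k α ∘ₗ f := by
  obtain ⟨g, rfl⟩ := (Ext.linearEquiv₀ (R := R)).symm.surjective α
  have : pb k f 0 ((Ext.linearEquiv₀ (R := R)).symm g) =
    (Ext.linearEquiv₀ (R := R)).symm (ModuleCat.ofHom f ≫ g) := by
    simp [pb, Ext.linearEquiv₀, Ext.addEquiv₀, Ext.homEquiv₀]
  rw [this]
  simp only [EE0, LinearEquiv.trans_apply, LinearEquiv.apply_symm_apply]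
  rfl

lemma bt_free0 (r : ℕ) (hk : Module.length R k = 1) :
    bt (R := R) k (Fin r → R) 0 = r := by
  rw [bt, (EE0 k).length_eq, ← ((Pi.basisFun R (Fin r)).constr R (M' := k)).length_eq,
    Module.length_pi_of_fintype]
  simp [hk]

lemma bt_free_succ [Module.Projective R M] (i : ℕ) : bt (R := R) k M (i + 1) = 0 := by
  have : Subsingleton (EE R k M (i+1)) := ⟨fun a b => by
    rw [EE_free_zero k i a, EE_free_zero k i b]⟩
  exact Module.length_eq_zero
end layer1

section layer2
variable {R : Type} [CommRing R] (m : Ideal R)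

lemma kill_quot (r : R) (hr : r ∈ m) (x : R ⧸ m) : r • x = 0 := by
  obtain ⟨y, rfl⟩ := Ideal.Quotient.mk_surjective x
  rw [← Ideal.Quotient.mk_eq_mk, ← Submodule.Quotient.mk_smul, Ideal.Quotient.mk_eq_mk,
    Ideal.Quotient.eq_zero_iff_mem]
  exact m.mul_mem_right _ hr

lemma length_quot [m.IsMaximal] : Module.length R (R ⧸ m) = 1 := by
  rw [Module.length_eq_one_iff, isSimpleModule_iff_isCoatom]
  exact (Ideal.isMaximal_def).1 inferInstance

/-- The Betti numbers of `M` are given by the coefficients of `p`. -/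
def HasB (M : Type) [AddCommGroup M] [Module R M] (p : Polynomial ℕ) : Prop :=
  ∀ i, bt (R := R) (R ⧸ m) M i = (p.coeff i : ℕ∞)

/-- A linear map inducing zero on Ext. -/
def ZM {M N : Type} [AddCommGroup M] [Module R M] [AddCommGroup N] [Module R N]
    (f : M →ₗ[R] N) : Prop := ∀ i α, pb (R ⧸ m) f i α = 0

variable {M N L : Type} [AddCommGroup M] [Module R M] [AddCommGroup N] [Module R N]
  [AddCommGroup L] [Module R L]

lemma ZM_smul (r : R) (hr : r ∈ m) (f : M →ₗ[R] N) : ZM m (r • f) := fun i α => by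
  rw [pb_smul, smul_eq_zero_of_kill _ r (kill_quot m r hr)]

lemma ZM_comp_right {f : M →ₗ[R] N} (hf : ZM m f) (g : L →ₗ[R] M) : ZM m (f ∘ₗ g) := fun i α => by
  rw [← pb_comp, hf, map_zero]

lemma ZM_free {r : ℕ} (f : M →ₗ[R] (Fin r → R)) (hf : ∀ x j, f x j ∈ m) : ZM m f := by
  intro i α
  cases i with
  | succ i => rw [EE_free_zero _ i α, map_zero]
  | zero =>
    apply (EE0 (R ⧸ m)).injective
    rw [EE0_pb, map_zero]
    ext x
    rw [LinearMap.comp_apply, LinearMap.pi_apply_eq_sum_univ]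
    simp only [LinearMap.zero_apply]
    exact Finset.sum_eq_zero fun j _ => kill_quot m _ (hf x j) _

lemma ZM_ring (f : M →ₗ[R] R) (hf : ∀ x, f x ∈ m) : ZM m f := by
  intro i α
  cases i with
  | succ i => rw [EE_free_zero _ i α, map_zero]
  | zero =>
    apply (EE0 (R ⧸ m)).injective
    rw [EE0_pb, map_zero]
    ext x
    rw [LinearMap.comp_apply, ← mul_one (f x), ← smul_eq_mul, map_smul]
    exact kill_quot m _ (hf x) _

lemma HasB_zero [Subsingleton M] : HasB (R := R) m M 0 := fun i => by
  have : Subsingleton (EE R (R ⧸ m) M i) := ⟨fun a b => by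
    rw [EE_subsingleton _ i a, EE_subsingleton _ i b]⟩
  rw [bt, Module.length_eq_zero]; simp

lemma bt_equiv (k : Type) [AddCommGroup k] [Module R k] (e : M ≃ₗ[R] N) (i : ℕ) :
    bt (R := R) k M i = bt (R := R) k N i := by
  refine LinearEquiv.length_eq (LinearEquiv.ofLinearMap (pb k e.symm.toLinearMap i)
    (pb k e.toLinearMap i) ?_ ?_)
  · ext α; simp [pb_comp, pb_id]
  · ext α; simp [pb_comp, pb_id]

lemma HasB_top [m.IsMaximal] : HasB (R := R) m (⊤ : Ideal R) 1 := fun i => by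
  rw [bt_equiv (R := R) (R ⧸ m) (Submodule.topEquiv.trans (LinearEquiv.funUnique (Fin 1) R R).symm)]
  cases i with
  | zero => rw [bt_free0 _ _ (length_quot m)]; simp
  | succ i => rw [bt_free_succ]; simp [Polynomial.coeff_one]

/-- The basic splitting lemma. -/
lemma HasB_split (Q P T L : Ideal R) (u : R)
    (hLP : L ≤ P) (hLQ : ∀ p ∈ L, u * p ∈ Q)
    (hL : ∀ p ∈ P, u * p ∈ Q → p ∈ L)
    (hQT : Q ≤ T) (hPT : ∀ p ∈ P, u * p ∈ T)
    (hT : ∀ t ∈ T, ∃ q ∈ Q, ∃ p ∈ P, t = q + u * p)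
    (h1 : ZM m (((u • LinearMap.id : R →ₗ[R] R).restrict (p := L) (q := Q) hLQ)))
    (h2 : ZM m (Submodule.inclusion hLP))
    {q p l : Polynomial ℕ} (hq : HasB (R := R) m Q q) (hp : HasB (R := R) m P p)
    (hl : HasB (R := R) m L l) :
    HasB (R := R) m T (q + p + Polynomial.X * l) := by
  set f1 : L →ₗ[R] Q := (u • LinearMap.id : R →ₗ[R] R).restrict (p := L) (q := Q) hLQ with hf1
  set f2 : L →ₗ[R] P := Submodule.inclusion hLP with hf2
  set g1 : Q →ₗ[R] T := Submodule.inclusion hQT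
  set g2 : P →ₗ[R] T := (u • LinearMap.id : R →ₗ[R] R).restrict (p := P) (q := T) hPT
  have e1 : ∀ x, ((f1 x : Q) : R) = u * x := fun x => rfl
  have e2 : ∀ x, ((f2 x : P) : R) = x := fun x => rfl
  have e3 : ∀ x, ((g1 x : T) : R) = x := fun x => rfl
  have e4 : ∀ x, ((g2 x : T) : R) = u * x := fun x => rfl
  have key := bt_ses (R ⧸ m) (f1.prod f2) (g1.coprod (-g2)) ?_ ?_ ?_ ?_
  · intro i
    cases i with
    | zero =>
      rw [key.1, bt_prod, hq, hp]; simp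
    | succ i =>
      rw [key.2, bt_prod, hq, hp, hl]; simp
  · intro x y h
    have := congrArg Prod.snd h
    exact Submodule.inclusion_injective hLP this
  · rintro ⟨x, y⟩
    constructor
    · intro h
      have h' : (x : R) + -(u * y) = 0 := congrArg Subtype.val h
      have hx : (x : R) = u * y := by linear_combination h'
      refine ⟨⟨y, hL y y.2 (hx ▸ x.2)⟩, ?_⟩
      apply Prod.ext
      · exact Subtype.ext hx.symm
      · exact Subtype.ext rfl
    · rintro ⟨z, hz⟩
      rw [← hz]
      apply Subtype.ext
      change u * (z : R) + -(u * z) = 0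
      ring
  · rintro ⟨t, ht⟩
    obtain ⟨a, ha, b, hb, rfl⟩ := hT t ht
    refine ⟨(⟨a, ha⟩, ⟨-b, P.neg_mem hb⟩), Subtype.ext ?_⟩
    change a + -(u * -b) = a + u * b
    ring
  · intro i α
    have : f1.prod f2 = LinearMap.inl R Q P ∘ₗ f1 + LinearMap.inr R Q P ∘ₗ f2 := by
      ext x <;> simp
    rw [this, pb_add, ← pb_comp, ← pb_comp, h1, h2, add_zero]

lemma ZM_bot (P : Ideal R) : ZM m (Submodule.inclusion (bot_le : ⊥ ≤ P)) := fun i _ =>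
  EE_subsingleton _ i _

lemma ZM_step (W P W' : Ideal R) (x : R) (hx : x ∈ m) (hW : W ≤ P) (hW' : W' ≤ P)
    (hdec : ∀ t ∈ W', ∃ q ∈ W, ∃ p ∈ P, t = q + x * p)
    (hreg : ∀ p ∈ P, x * p ∈ W → p ∈ W)
    (hz : ZM m (Submodule.inclusion hW)) : ZM m (Submodule.inclusion hW') := by
  intro i α
  let D := LinearMap.range (Submodule.inclusion hW)
  let mx : (P ⧸ D) →ₗ[R] (P ⧸ D) := x • LinearMap.id
  have hinj : Function.Injective mx := by
    rw [injective_iff_map_eq_zero]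
    intro a ha
    obtain ⟨⟨p, hp⟩, rfl⟩ := D.mkQ_surjective a
    change x • D.mkQ ⟨p, hp⟩ = 0 at ha
    rw [← map_smul, Submodule.mkQ_apply, Submodule.Quotient.mk_eq_zero] at ha
    rw [Submodule.mkQ_apply, Submodule.Quotient.mk_eq_zero]
    obtain ⟨⟨z, hz⟩, h⟩ := ha
    have h' : z = x * p := congrArg Subtype.val h
    exact ⟨⟨p, hreg p hp (h' ▸ hz)⟩, rfl⟩
  obtain ⟨β, rfl⟩ := (les2 (R ⧸ m) (Submodule.inclusion hW) D.mkQ (Submodule.inclusion_injective hW)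
    (LinearMap.exact_map_mkQ_range _) (Submodule.mkQ_surjective _) i α).1 (hz i α)
  obtain ⟨γ, rfl⟩ := (les2 (R ⧸ m) mx (LinearMap.range mx).mkQ hinj
    (LinearMap.exact_map_mkQ_range _) (Submodule.mkQ_surjective _) i β).1 (ZM_smul m x hx _ i β)
  rw [pb_comp, pb_comp]
  convert pb_zero (R ⧸ m) i γ
  ext ⟨t, ht⟩
  obtain ⟨q, hq, p, hp, rfl⟩ := hdec t ht
  simp only [LinearMap.comp_apply, LinearMap.zero_apply, Submodule.mkQ_apply]
  rw [Submodule.Quotient.mk_eq_zero]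
  refine ⟨D.mkQ ⟨p, hp⟩, ?_⟩
  change x • D.mkQ ⟨p, hp⟩ = D.mkQ _
  rw [← map_smul, ← sub_eq_zero, ← map_sub, Submodule.mkQ_apply, Submodule.Quotient.mk_eq_zero]
  refine ⟨⟨-q, W.neg_mem hq⟩, Subtype.ext ?_⟩
  change -q = x * p - (q + x * p)
  ring

lemma bt_cover [m.IsMaximal] {r : ℕ} (f : M →ₗ[R] (Fin r → R)) (g : (Fin r → R) →ₗ[R] N)
    (hf : Function.Injective f)
    (hfg : Function.Exact f g) (hg : Function.Surjective g) (hm : ∀ x j, f x j ∈ m) :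
    bt (R := R) (R ⧸ m) N 0 = r ∧
      ∀ i, bt (R := R) (R ⧸ m) N (i + 1) = bt (R := R) (R ⧸ m) M i := by
  obtain ⟨h0, h1⟩ := bt_ses (R ⧸ m) f g hf hfg hg (ZM_free m f hm)
  refine ⟨by rw [h0, bt_free0 _ _ (length_quot m)], fun i => ?_⟩
  rw [h1, bt_free_succ, zero_add]

end layer2

section layer3
variable {K : Type} [Field K] {σ : Type} [Fintype σ] [DecidableEq σ] (w : σ → ℕ)

/-- The set of variables whose exponent reaches the weight. -/
def Tm (a : σ →₀ ℕ) : Finset σ := Finset.univ.filter fun v => w v ≤ a v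

lemma mem_Tm {a : σ →₀ ℕ} {v : σ} : v ∈ Tm w a ↔ w v ≤ a v := by simp [Tm]

lemma Tm_mono {a b : σ →₀ ℕ} (h : a ≤ b) : Tm w a ⊆ Tm w b := by
  intro v hv
  rw [mem_Tm] at *
  exact hv.trans (h v)

/-- The exponent of the product of the weighted variables in `S`. -/
noncomputable def eS (S : Finset σ) : σ →₀ ℕ :=
  Finsupp.equivFunOnFinite.symm fun v => if v ∈ S then w v else 0

lemma eS_apply (S : Finset σ) (v : σ) : eS w S v = if v ∈ S then w v else 0 := rfl

lemma Tm_add (a : σ →₀ ℕ) (S : Finset σ) : Tm w (a + eS w S) = Tm w a ∪ S := by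
  ext v
  rw [Finset.mem_union, mem_Tm, mem_Tm, Finsupp.add_apply, eS_apply]
  split_ifs with h <;> simp [h]

lemma Tm_sub (a : σ →₀ ℕ) (S : Finset σ) : Tm w a \ S ⊆ Tm w (a - eS w S) := by
  intro v
  rw [Finset.mem_sdiff, mem_Tm, mem_Tm, Finsupp.tsub_apply, eS_apply]
  rintro ⟨h1, h2⟩
  simp [h1, h2]

lemma eS_le {a : σ →₀ ℕ} {S : Finset σ} (h : S ⊆ Tm w a) : eS w S ≤ a := by
  intro v
  rw [eS_apply]
  split_ifs with hv
  · exact (mem_Tm w).1 (h hv)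
  · exact Nat.zero_le _

variable (K) in
/-- The ideal spanned by the monomials with `Tm w a` satisfying `φ` (upwards closed). -/
noncomputable def sq (φ : Finset σ → Prop) : Ideal (MvPolynomial σ K) where
  carrier := {p | ∀ a ∈ p.support, ∀ B, Tm w a ⊆ B → φ B}
  zero_mem' := by simp
  add_mem' := by
    intro p q hp hq a ha
    rcases Finset.mem_union.1 (support_add ha) with h | h
    · exact hp a h
    · exact hq a h
  smul_mem' := by
    intro c p hp a ha B hB
    rw [smul_eq_mul] at ha
    obtain ⟨b, _, d, hd, rfl⟩ := Finset.mem_add.1 (support_mul c p ha)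
    exact hp d hd B ((Tm_mono w (le_add_of_nonneg_left bot_le)).trans hB)

lemma mem_sq {φ : Finset σ → Prop} (hφ : Monotone φ) (p : MvPolynomial σ K) :
    p ∈ sq K w φ ↔ ∀ a ∈ p.support, φ (Tm w a) :=
  ⟨fun h a ha => h a ha _ subset_rfl, fun h a ha _ hB => hφ hB (h a ha)⟩

variable (K) in
/-- The product of the weighted variables in `S`. -/
noncomputable def uS (S : Finset σ) : MvPolynomial σ K := monomial (eS w S) 1

lemma uS_mul_mem {φ : Finset σ → Prop} (hφ : Monotone φ) (S : Finset σ) (p : MvPolynomial σ K) :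
    uS K w S * p ∈ sq K w φ ↔ ∀ a ∈ p.support, φ (Tm w a ∪ S) := by
  rw [mem_sq w hφ]
  constructor
  · intro h a ha
    rw [← Tm_add]
    apply h
    rw [mem_support_iff, add_comm, uS, coeff_monomial_mul, one_mul]
    exact mem_support_iff.1 ha
  · intro h a ha
    obtain ⟨b, hb, d, hd, rfl⟩ := Finset.mem_add.1 (support_mul _ p ha)
    have : b = eS w S := by
      have := support_monomial_subset hb
      simpa using this
    rw [this, add_comm, Tm_add]
    exact h d hd

lemma uS_insert {s : σ} {S : Finset σ} (hs : s ∉ S) :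
    uS K w (insert s S) = uS K w {s} * uS K w S := by
  rw [uS, uS, uS, monomial_mul, one_mul]
  have e : eS w (insert s S) = eS w {s} + eS w S := by
   ext v
   simp only [Finsupp.add_apply, eS_apply, Finset.mem_insert, Finset.mem_singleton]
   by_cases h1 : v = s
   · subst h1; simp [hs]
   · simp [h1]
  rw [e]

lemma sq_dec {φT φQ φP : Finset σ → Prop} (hT : Monotone φT) (hQ : Monotone φQ) (hP : Monotone φP)
    (S : Finset σ) (h : ∀ B, φT B → φQ B ∨ (S ⊆ B ∧ φP (B \ S)))
    (t : MvPolynomial σ K) (ht : t ∈ sq K w φT) :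
    ∃ q ∈ sq K w φQ, ∃ p ∈ sq K w φP, t = q + uS K w S * p := by
  have key : t ∈ sq K w φQ ⊔ Submodule.map
      (uS K w S • LinearMap.id : MvPolynomial σ K →ₗ[MvPolynomial σ K] MvPolynomial σ K)
      (sq K w φP) := by
    rw [t.as_sum]
    refine Submodule.sum_mem _ fun a ha => ?_
    rcases h _ ((mem_sq w hT t).1 ht a ha) with h1 | ⟨h1, h2⟩
    · refine Submodule.mem_sup_left ((mem_sq w hQ _).2 fun b hb => ?_)
      have := support_monomial_subset hb
      rw [Finset.mem_singleton] at this
      rwa [this]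
    · refine Submodule.mem_sup_right ⟨monomial (a - eS w S) (coeff a t), ?_, ?_⟩
      · refine (mem_sq w hP _).2 fun b hb => ?_
        have := support_monomial_subset hb
        rw [Finset.mem_singleton] at this
        rw [this]
        exact hP (Tm_sub w a S) h2
      · simp only [LinearMap.smul_apply, LinearMap.id_apply, smul_eq_mul, uS, monomial_mul, one_mul]
        rw [add_tsub_cancel_of_le (eS_le w h1)]
  obtain ⟨q, hq, z, ⟨p, hp, rfl⟩, rfl⟩ := Submodule.mem_sup.1 key
  exact ⟨q, hq, p, hp, rfl⟩

variable (K σ) in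
/-- The irrelevant maximal ideal. -/
noncomputable abbrev mI : Ideal (MvPolynomial σ K) := RingHom.ker (constantCoeff (σ := σ) (R := K))

instance : (mI K σ).IsMaximal :=
  RingHom.ker_isMaximal_of_surjective _ fun x => ⟨C x, constantCoeff_C _ x⟩

lemma uS_mem (hw : ∀ v, 1 ≤ w v) (s : σ) : uS K w {s} ∈ mI K σ := by
  rw [RingHom.mem_ker, uS, constantCoeff_monomial, if_neg]
  intro h
  have := DFunLike.congr_fun h s
  simp only [eS_apply, Finset.mem_singleton, if_true, Finsupp.zero_apply] at this
  have := hw s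
  omega

lemma sq_le_mI (hw : ∀ v, 1 ≤ w v) {φ : Finset σ → Prop} (h0 : ¬ φ ∅) : sq K w φ ≤ mI K σ := by
  intro p hp
  rw [RingHom.mem_ker, constantCoeff_eq]
  by_contra hc
  apply h0
  apply hp 0 (mem_support_iff.2 hc)
  intro v hv
  have := hw v
  rw [mem_Tm, Finsupp.zero_apply] at hv
  omega

lemma sq_mono {φ ψ : Finset σ → Prop} (h : ∀ B, φ B → ψ B) : sq K w φ ≤ sq K w ψ :=
  fun _ hp a ha B hB => h B (hp a ha B hB)

lemma sq_split (hw : ∀ v, 1 ≤ w v) {φQ φP φT φL : Finset σ → Prop}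
    (mQ : Monotone φQ) (mP : Monotone φP) (mT : Monotone φT) (mL : Monotone φL)
    (s : σ) (S : Finset σ) (hs : s ∉ S)
    (hLP : ∀ B, φL B → φP B) (hLQ : ∀ B, φL B → φQ (B ∪ S))
    (hL : ∀ B, φP B → φQ (B ∪ insert s S) → φL B)
    (hQT : ∀ B, φQ B → φT B) (hPT : ∀ B, φP B → φT (B ∪ insert s S))
    (hT : ∀ B, φT B → φQ B ∨ (insert s S ⊆ B ∧ φP (B \ insert s S)))
    (h2 : ZM (mI K σ) (Submodule.inclusion (sq_mono (K := K) w hLP)))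
    {q p l : Polynomial ℕ} (hq : HasB (mI K σ) (sq K w φQ) q) (hp : HasB (mI K σ) (sq K w φP) p)
    (hl : HasB (mI K σ) (sq K w φL) l) :
    HasB (mI K σ) (sq K w φT) (q + p + Polynomial.X * l) := by
  have hLQ1 : ∀ p ∈ sq K w φL, uS K w S * p ∈ sq K w φQ := fun p hp =>
    (uS_mul_mem w mQ S p).2 fun a ha => hLQ _ ((mem_sq w mL p).1 hp a ha)
  have hLQ2 : ∀ p ∈ sq K w φL, uS K w (insert s S) * p ∈ sq K w φQ := fun p hp => by
    rw [uS_insert w hs, mul_assoc]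
    exact Ideal.mul_mem_left _ _ (hLQ1 p hp)
  refine HasB_split (mI K σ) (sq K w φQ) (sq K w φP) (sq K w φT) (sq K w φL)
    (uS K w (insert s S)) (sq_mono w hLP) hLQ2 ?_ (sq_mono w hQT) ?_ ?_ ?_ h2 hq hp hl
  · intro p hp h
    rw [uS_mul_mem w mQ] at h
    rw [mem_sq w mP] at hp
    rw [mem_sq w mL]
    exact fun a ha => hL _ (hp a ha) (h a ha)
  · intro p hp
    rw [uS_mul_mem w mT]
    rw [mem_sq w mP] at hp
    exact fun a ha => hPT _ (hp a ha)
  · exact sq_dec w mT mQ mP _ hT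
  · have := ZM_smul (mI K σ) (uS K w {s}) (uS_mem w hw s)
      ((uS K w S • LinearMap.id : MvPolynomial σ K →ₗ[MvPolynomial σ K] MvPolynomial σ K).restrict
        (p := sq K w φL) (q := sq K w φQ) hLQ1)
    convert this using 1
    ext x : 2
    change uS K w (insert s S) * (x : MvPolynomial σ K) = uS K w {s} * (uS K w S * x)
    rw [uS_insert w hs, mul_assoc]

lemma sq_true : sq K w (fun _ : Finset σ => True) = ⊤ := by
  rw [eq_top_iff]; intro p _ a _ B _; trivial

lemma sq_false : sq K w (fun _ : Finset σ => False) = ⊥ := by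
  rw [eq_bot_iff]; intro p hp
  rw [Submodule.mem_bot, ← support_eq_empty, Finset.eq_empty_iff_forall_notMem]
  exact fun a ha => hp a ha _ subset_rfl

lemma HasB_true : HasB (mI K σ) (sq K w (fun _ : Finset σ => True)) 1 := by
  rw [sq_true]; exact HasB_top _

lemma HasB_false : HasB (mI K σ) (sq K w (fun _ : Finset σ => False)) 0 := by
  rw [sq_false]; exact HasB_zero _

lemma ZM_top (hw : ∀ v, 1 ≤ w v) {φ : Finset σ → Prop} (h0 : ¬ φ ∅) (h : ∀ B, φ B → True) :
    ZM (mI K σ) (Submodule.inclusion (sq_mono (K := K) w h)) := by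
  have hle : ∀ x : sq K w φ, (x : MvPolynomial σ K) ∈ mI K σ := fun x => sq_le_mI w hw h0 x.2
  have h1 := ZM_ring (mI K σ) (sq K w φ).subtype hle
  have e : (sq K w (fun _ : Finset σ => True)) = ⊤ := sq_true w
  let g : MvPolynomial σ K →ₗ[MvPolynomial σ K] sq K w (fun _ : Finset σ => True) :=
    LinearMap.codRestrict _ LinearMap.id (fun x => by rw [e]; trivial)
  intro i α
  have : Submodule.inclusion (sq_mono (K := K) w h) = g ∘ₗ (sq K w φ).subtype := by
    ext x; rfl
  rw [this, ← pb_comp, h1]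

/-- adding one generator `u_S` to `φQ`, with colon `φL`. -/
lemma sq_add_gen (hw : ∀ v, 1 ≤ w v) {φQ φL : Finset σ → Prop}
    (mQ : Monotone φQ) (mL : Monotone φL)
    (s : σ) (S : Finset σ) (hs : s ∉ S) (h0 : ¬ φL ∅)
    (hLQ : ∀ B, φL B → φQ (B ∪ S))
    (hL : ∀ B, φQ (B ∪ insert s S) → φL B)
    {q l : Polynomial ℕ} (hq : HasB (mI K σ) (sq K w φQ) q)
    (hl : HasB (mI K σ) (sq K w φL) l) :
    HasB (mI K σ) (sq K w (fun B => φQ B ∨ insert s S ⊆ B)) (q + 1 + Polynomial.X * l) := by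
  refine sq_split w hw mQ (fun _ _ _ => id) ?_ mL s S hs (fun _ _ => trivial) hLQ
    (fun B _ => hL B) (fun B h => Or.inl h) (fun B _ => Or.inr Finset.subset_union_right)
    (fun B h => h.imp id fun h => ⟨h, trivial⟩) (ZM_top w hw h0 (fun _ _ => trivial)) hq (HasB_true w) hl
  intro B B' h hB
  exact hB.imp (mQ h) (fun h' => h'.trans h)

lemma sq_congr {φ ψ : Finset σ → Prop} (h : ∀ B, φ B ↔ ψ B) : sq K w φ = sq K w ψ := by
  rw [show φ = ψ from funext fun B => propext (h B)]

/-- adding a new weighted variable -/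
lemma sq_add_var (hw : ∀ v, 1 ≤ w v) {φ : Finset σ → Prop} (mφ : Monotone φ) (s : σ)
    (h0 : ¬ φ ∅) (hs : ∀ B, φ (insert s B) → φ B) {q : Polynomial ℕ}
    (hq : HasB (mI K σ) (sq K w φ) q) :
    HasB (mI K σ) (sq K w (fun B => φ B ∨ s ∈ B)) (q + 1 + Polynomial.X * q) := by
  have := sq_add_gen w hw mφ mφ s ∅ (Finset.notMem_empty s) h0 (by simp)
    (fun B h => hs B (by
      rwa [show B ∪ insert s ∅ = insert s B by ext; simp [or_comm]] at h)) hq hq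
  rwa [sq_congr (K := K) w (ψ := fun B => φ B ∨ s ∈ B) (fun B => by
    rw [show insert s (∅ : Finset σ) = {s} from rfl, Finset.singleton_subset_iff])] at this

end layer3

section layer4
variable {K : Type} [Field K] {σ : Type} [Fintype σ] [DecidableEq σ] (w : σ → ℕ)

lemma prop1 (a b c : Prop) : (a ∨ b) ∨ c ↔ a ∨ c ∨ b := by tauto
lemma prop2 (a b c d : Prop) : (a ∨ b ∧ c) ∨ b ∧ d ↔ a ∨ b ∧ (d ∨ c) := by tauto

lemma add_vars (hw : ∀ v, 1 ≤ w v) {φ : Finset σ → Prop} (mφ : Monotone φ) (h0 : ¬ φ ∅)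
    {q : Polynomial ℕ} (hq : HasB (mI K σ) (sq K w φ) q) (A : Finset σ)
    (hA : ∀ s ∈ A, ∀ B, φ (insert s B) → φ B) :
    ∃ p : Polynomial ℕ, HasB (mI K σ) (sq K w (fun B => φ B ∨ ∃ j ∈ A, j ∈ B)) p ∧
      1 + Polynomial.X * p = (1 + Polynomial.X) ^ A.card * (1 + Polynomial.X * q) := by
  induction A using Finset.induction_on with
  | empty =>
    refine ⟨q, ?_, by simp⟩
    rwa [sq_congr (K := K) w (ψ := φ) (fun B => by simp)]
  | insert s A hs ih =>
    obtain ⟨p, hp, e⟩ := ih (fun t ht => hA t (Finset.mem_insert_of_mem ht))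
    refine ⟨p + 1 + Polynomial.X * p, ?_, ?_⟩
    · have := sq_add_var w hw (φ := fun B => φ B ∨ ∃ j ∈ A, j ∈ B) ?_ s ?_ ?_ hp
      · rwa [sq_congr (K := K) w (ψ := fun B => φ B ∨ ∃ j ∈ insert s A, j ∈ B) (fun B => by
          simp only [Finset.exists_mem_insert]; exact prop1 _ _ _)] at this
      · intro B B' h hB
        exact hB.imp (mφ h) (fun ⟨j, hj, hjB⟩ => ⟨j, hj, h hjB⟩)
      · simpa using h0
      · rintro B (h | ⟨j, hj, h⟩)
        · exact Or.inl (hA s (Finset.mem_insert_self _ _) B h)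
        · refine Or.inr ⟨j, hj, ?_⟩
          rcases Finset.mem_insert.1 h with rfl | h
          · exact absurd hj hs
          · exact h
    · rw [Finset.card_insert_of_notMem hs, pow_succ, mul_right_comm, ← e]
      ring

lemma HasB_U (hw : ∀ v, 1 ≤ w v) (A : Finset σ) :
    ∃ p : Polynomial ℕ, HasB (mI K σ) (sq K w (fun B => ∃ j ∈ A, j ∈ B)) p ∧
      1 + Polynomial.X * p = (1 + Polynomial.X) ^ A.card := by
  obtain ⟨p, hp, e⟩ := add_vars (K := K) w hw (φ := fun _ => False) (fun _ _ _ => id) id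
    (HasB_false w) A (by simp)
  refine ⟨p, ?_, by simpa using e⟩
  rwa [sq_congr (K := K) w (ψ := fun B => ∃ j ∈ A, j ∈ B) (fun B => by simp)] at hp

/-- Two distinct elements of `A` in `B`. -/
def VV (A B : Finset σ) : Prop := ∃ i ∈ A, ∃ j ∈ A, i ≠ j ∧ i ∈ B ∧ j ∈ B

lemma VV_mono (A : Finset σ) : Monotone (VV A) := by
  rintro B B' h ⟨i, hi, j, hj, hij, h1, h2⟩
  exact ⟨i, hi, j, hj, hij, h h1, h h2⟩

lemma HasB_V_step (hw : ∀ v, 1 ≤ w v) (A : Finset σ) (t : σ) (ht : t ∉ A) {q : Polynomial ℕ}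
    (hq : HasB (mI K σ) (sq K w (VV A)) q) (J : Finset σ) (hJ : J ⊆ A) :
    HasB (mI K σ) (sq K w (fun B => VV A B ∨ (t ∈ B ∧ ∃ j ∈ J, j ∈ B)))
      (q + J.card • (1 + Polynomial.X) ^ (A.card - 1)) := by
  induction J using Finset.induction_on with
  | empty =>
    rw [sq_congr (K := K) w (ψ := VV A) (fun B => by simp)]
    simpa using hq
  | insert j J hj ih =>
    have hJ' : J ⊆ A := (Finset.subset_insert _ _).trans hJ
    have hjA : j ∈ A := hJ (Finset.mem_insert_self _ _)
    obtain ⟨p, hp, e⟩ := HasB_U (K := K) w hw (A.erase j)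
    have htj : t ≠ j := fun h => ht (h ▸ hjA)
    have := sq_add_gen w hw (φQ := fun B => VV A B ∨ (t ∈ B ∧ ∃ j ∈ J, j ∈ B))
      (φL := fun B => ∃ i ∈ A.erase j, i ∈ B) ?_ ?_ t {j} (by simpa using htj) (by simp)
      ?_ ?_ (ih hJ') hp
    · rw [sq_congr (K := K) w
        (ψ := fun B => VV A B ∨ (t ∈ B ∧ ∃ i ∈ insert j J, i ∈ B)) (fun B => by
          simp only [Finset.exists_mem_insert, Finset.insert_subset_iff,
            Finset.singleton_subset_iff]; exact prop2 _ _ _ _)] at this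
      convert this using 1
      rw [Finset.card_insert_of_notMem hj, ← Finset.card_erase_of_mem hjA, ← e, succ_nsmul]
      ring
    · intro B B' h hB
      exact hB.imp (fun h' => VV_mono A h h') (fun ⟨h1, j, hj, hjB⟩ => ⟨h h1, j, hj, h hjB⟩)
    · rintro B B' h ⟨i, hi, hiB⟩
      exact ⟨i, hi, h hiB⟩
    · rintro B ⟨i, hi, hiB⟩
      rw [Finset.mem_erase] at hi
      exact Or.inl ⟨i, hi.2, j, hjA, hi.1, by simp [hiB], by simp⟩
    · rintro B (⟨i, hi, k, hk, hik, h1, h2⟩ | ⟨_, i, hi, h⟩)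
      · have hit : i ≠ t := fun h => ht (h ▸ hi)
        have hkt : k ≠ t := fun h => ht (h ▸ hk)
        simp only [Finset.mem_union, Finset.mem_insert, Finset.mem_singleton, hit, hkt,
          false_or] at h1 h2
        by_cases hij : i = j
        · have hkj : k ≠ j := fun h => hik (hij.trans h.symm)
          exact ⟨k, Finset.mem_erase.2 ⟨hkj, hk⟩, by simpa [hkj] using h2⟩
        · exact ⟨i, Finset.mem_erase.2 ⟨hij, hi⟩, by simpa [hij] using h1⟩
      · have hij : i ≠ j := fun h => hj (h ▸ hi)
        have hit : i ≠ t := fun h => ht (h ▸ hJ' hi)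
        exact ⟨i, Finset.mem_erase.2 ⟨hij, hJ' hi⟩, by simpa [hij, hit] using h⟩

lemma HasB_V (hw : ∀ v, 1 ≤ w v) (A : Finset σ) :
    ∃ p : Polynomial ℕ, HasB (mI K σ) (sq K w (VV A)) p ∧
      Polynomial.X ^ 2 * p + (1 + Polynomial.X) ^ A.card =
        A.card • (Polynomial.X * (1 + Polynomial.X) ^ (A.card - 1)) + 1 := by
  induction A using Finset.induction_on with
  | empty =>
    refine ⟨0, ?_, by simp⟩
    rw [sq_congr (K := K) w (ψ := fun _ => False) (fun B => by simp [VV])]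
    exact HasB_false w
  | insert t A ht ih =>
    obtain ⟨p, hp, e⟩ := ih
    refine ⟨p + A.card • (1 + Polynomial.X) ^ (A.card - 1), ?_, ?_⟩
    · have := HasB_V_step w hw A t ht hp A subset_rfl
      rwa [sq_congr (K := K) w (ψ := VV (insert t A)) (fun B => ?_)] at this
      constructor
      · rintro (⟨i, hi, j, hj, h⟩ | ⟨h, j, hj, hjB⟩)
        · exact ⟨i, Finset.mem_insert_of_mem hi, j, Finset.mem_insert_of_mem hj, h⟩
        · exact ⟨t, Finset.mem_insert_self _ _, j, Finset.mem_insert_of_mem hj,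
            fun h => ht (h ▸ hj), h, hjB⟩
      · rintro ⟨i, hi, j, hj, hij, h1, h2⟩
        rcases Finset.mem_insert.1 hi with rfl | hi
        · rcases Finset.mem_insert.1 hj with rfl | hj
          · exact absurd rfl hij
          · exact Or.inr ⟨h1, j, hj, h2⟩
        · rcases Finset.mem_insert.1 hj with hj | hj
          · exact Or.inr ⟨hj ▸ h2, i, hi, h1⟩
          · exact Or.inl ⟨i, hi, j, hj, hij, h1, h2⟩
    · rw [Finset.card_insert_of_notMem ht, Nat.add_sub_cancel]
      rcases Nat.eq_zero_or_pos A.card with h | h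
      · rw [h] at e ⊢
        simp only [zero_smul, pow_zero] at e
        simp only [zero_smul, pow_zero, zero_add, pow_one, one_smul, add_zero, mul_one]
        calc _ = (Polynomial.X ^ 2 * p + 1) + Polynomial.X := by ring
          _ = _ := by rw [e]; ring
      · obtain ⟨k, hk⟩ := Nat.exists_eq_succ_of_ne_zero h.ne'
        rw [hk] at e ⊢
        simp only [Nat.succ_eq_add_one, Nat.add_sub_cancel, nsmul_eq_mul] at e ⊢
        push_cast at e ⊢
        calc _ = (Polynomial.X ^ 2 * p + (1 + Polynomial.X) ^ (k + 1)) +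
              (Polynomial.X * (1 + Polynomial.X) ^ (k + 1) +
                ((k : Polynomial ℕ) + 1) * Polynomial.X ^ 2 * (1 + Polynomial.X) ^ k) := by ring
          _ = _ := by rw [e]; ring

end layer4

section layer5
variable {K : Type} [Field K] {ι : Type} [Fintype ι] [DecidableEq ι] (w : ι ⊕ ι → ℕ)

lemma ZM_W (hw : ∀ v, 1 ≤ w v) {P : Finset (ι ⊕ ι) → Prop} (mP : Monotone P)
    (hP : ∀ k B, P (insert (Sum.inl k) B) → P B) (s : Finset ι) :
    ZM (mI K (ι ⊕ ι)) (Submodule.inclusion (sq_mono (K := K) w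
      (φ := fun B => (∃ i ∈ s, Sum.inl i ∈ B) ∧ P B) (ψ := P) (fun _ h => h.2))) := by
  induction s using Finset.induction_on with
  | empty =>
    have e : sq K w (fun B : Finset (ι ⊕ ι) => (∃ i ∈ (∅ : Finset ι), Sum.inl i ∈ B) ∧ P B) = ⊥ := by
      rw [← sq_false (K := K) w]
      exact sq_congr w (by simp)
    have : Subsingleton
        (sq K w (fun B : Finset (ι ⊕ ι) => (∃ i ∈ (∅ : Finset ι), Sum.inl i ∈ B) ∧ P B)) := by
      rw [e]; infer_instance
    exact fun i _ => EE_subsingleton _ i _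
  | insert t s ht ih =>
    have mW : ∀ s : Finset ι, Monotone (fun B => (∃ i ∈ s, Sum.inl i ∈ B) ∧ P B) := by
      rintro s B B' h ⟨⟨i, hi, hiB⟩, h'⟩
      exact ⟨⟨i, hi, h hiB⟩, mP h h'⟩
    refine ZM_step (mI K (ι ⊕ ι)) _ _ _ (uS K w {Sum.inl t}) (uS_mem w hw _) _ _ ?_ ?_ ih
    · refine sq_dec w (mW _) (mW _) mP _ ?_
      rintro B ⟨⟨i, hi, hiB⟩, h⟩
      rcases Finset.mem_insert.1 hi with rfl | hi
      · refine Or.inr ⟨Finset.singleton_subset_iff.2 hiB, hP i _ (mP ?_ h)⟩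
        intro v hv
        by_cases hvi : v = Sum.inl i <;> simp [hvi, hv]
      · exact Or.inl ⟨⟨i, hi, hiB⟩, h⟩
    · intro p hp h
      rw [uS_mul_mem w (mW _)] at h
      rw [mem_sq w mP] at hp
      rw [mem_sq w (mW _)]
      intro a ha
      obtain ⟨⟨i, hi, hiB⟩, h'⟩ := h a ha
      have hit : i ≠ t := fun h => ht (h ▸ hi)
      exact ⟨⟨i, hi, by simpa [hit] using hiB⟩, hp a ha⟩

/-- The edge condition. -/
def Ed (s : Finset ι) (Y : ι → Finset (ι ⊕ ι) → Prop) (B : Finset (ι ⊕ ι)) : Prop :=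
  ∃ i ∈ s, Sum.inl i ∈ B ∧ Y i B

lemma Ed_mono (s : Finset ι) {Y : ι → Finset (ι ⊕ ι) → Prop} (mY : ∀ i, Monotone (Y i)) :
    Monotone (Ed s Y) := by
  rintro B B' h ⟨i, hi, h1, h2⟩
  exact ⟨i, hi, h h1, mY i h h2⟩

lemma HasB_E (hw : ∀ v, 1 ≤ w v) (s : Finset ι) : ∀ (Y : ι → Finset (ι ⊕ ι) → Prop)
    (_ : ∀ i, Monotone (Y i)) (_ : ∀ i k B, Y i (insert (Sum.inl k) B) → Y i B)
    (p : Finset ι → Polynomial ℕ)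
    (_ : ∀ A ⊆ s, A.Nonempty → HasB (mI K (ι ⊕ ι)) (sq K w (fun B => ∀ l ∈ A, Y l B)) (p A)),
    HasB (mI K (ι ⊕ ι)) (sq K w (Ed s Y))
      (∑ A ∈ s.powerset.erase ∅, Polynomial.X ^ (A.card - 1) * p A) := by
  induction s using Finset.induction_on with
  | empty =>
    intro Y mY hY p hp
    rw [sq_congr (K := K) w (ψ := fun _ => False) (fun B => by simp [Ed])]
    simpa using HasB_false w
  | insert t s ht ih =>
    intro Y mY hY p hp
    have hq := ih Y mY hY p (fun A hA => hp A (hA.trans (Finset.subset_insert _ _)))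
    have hpt := hp {t} (by simp) (by simp)
    rw [sq_congr (K := K) w (ψ := Y t) (fun B => by simp)] at hpt
    have mY' : ∀ i, Monotone (fun B => Y i B ∧ Y t B) := fun i B B' h h' =>
      ⟨mY i h h'.1, mY t h h'.2⟩
    have hl := ih (fun i B => Y i B ∧ Y t B) mY'
      (fun i k B h => ⟨hY _ _ _ h.1, hY _ _ _ h.2⟩) (fun A => p (insert t A)) (by
        intro A hA hne
        rw [sq_congr (K := K) w (ψ := fun B => ∀ l ∈ insert t A, Y l B)]
        · exact hp _ (Finset.insert_subset_insert _ hA) (by simp)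
        · intro B
          obtain ⟨a, ha⟩ := hne
          rw [Finset.forall_mem_insert]
          exact ⟨fun h => ⟨(h a ha).2, fun l hl => (h l hl).1⟩, fun h l hl => ⟨h.2 l hl, h.1⟩⟩)
    have hLP : ∀ B, Ed s (fun i B => Y i B ∧ Y t B) B → Y t B := by
      rintro B ⟨i, _, _, h⟩; exact h.2
    have hLW : ∀ B, Ed s (fun i B => Y i B ∧ Y t B) B → (∃ i ∈ s, Sum.inl i ∈ B) ∧ Y t B := by
      rintro B ⟨i, h1, h2, h⟩; exact ⟨⟨i, h1, h2⟩, h.2⟩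
    have h2 : ZM (mI K (ι ⊕ ι)) (Submodule.inclusion (sq_mono (K := K) w hLP)) :=
      ZM_comp_right _ (ZM_W w hw (mY t) (hY t) s) (Submodule.inclusion (sq_mono (K := K) w hLW))
    have e1 : ∀ B : Finset (ι ⊕ ι), B ∪ insert (Sum.inl t) ∅ = insert (Sum.inl t) B := by
      intro B; ext; simp
    have := sq_split w hw (Ed_mono s mY) (mY t) (Ed_mono (insert t s) mY) (Ed_mono s mY')
      (Sum.inl t) ∅ (by simp) hLP ?_ ?_ ?_ ?_ ?_ h2 hq hpt hl
    · convert this using 1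
      have e2 : ∅ ∈ s.powerset := Finset.empty_mem_powerset s
      have e3 : (insert t s).powerset.erase ∅ =
          s.powerset.erase ∅ ∪ s.powerset.image (insert t) := by
        rw [Finset.powerset_insert, Finset.erase_union_distrib, Finset.erase_eq_of_notMem (a := ∅)
          (s := s.powerset.image (insert t))]
        simp
      rw [e3, Finset.sum_union, Finset.sum_image, ← Finset.add_sum_erase _ _ e2, Finset.mul_sum,
        add_assoc]
      · congr 1
        have : (insert t (∅ : Finset ι)) = {t} := rfl
        rw [this]
        congr 1
        · simp
        · refine Finset.sum_congr rfl fun A hA => ?_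
          rw [Finset.mem_erase, Finset.mem_powerset] at hA
          have htA : t ∉ A := fun h => ht (hA.2 h)
          have hc : 0 < A.card := Finset.card_pos.2 (Finset.nonempty_iff_ne_empty.2 hA.1)
          rw [Finset.card_insert_of_notMem htA, ← mul_assoc, ← pow_succ',
            Nat.sub_add_cancel hc, Nat.add_sub_cancel]
      · intro A hA A' hA' h
        simp only [Finset.coe_powerset, Set.mem_preimage, Set.mem_powerset_iff,
          Finset.coe_subset] at hA hA'
        rw [← Finset.erase_insert (fun h => ht (hA h)), h,
          Finset.erase_insert (fun h => ht (hA' h))]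
      · rw [Finset.disjoint_left]
        intro A hA hA'
        obtain ⟨A', _, rfl⟩ := Finset.mem_image.1 hA'
        rw [Finset.mem_erase, Finset.mem_powerset] at hA
        exact ht (hA.2 (Finset.mem_insert_self _ _))
    · rintro B ⟨i, h1, h2, h⟩
      rw [Finset.union_empty]
      exact ⟨i, h1, h2, h.1⟩
    · rintro B hB ⟨i, h1, h2, h⟩
      rw [e1] at h2 h
      have hit : i ≠ t := fun h => ht (h ▸ h1)
      exact ⟨i, h1, by simpa [hit] using h2, hY _ _ _ h, hB⟩
    · rintro B ⟨i, h1, h2, h⟩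
      exact ⟨i, Finset.mem_insert_of_mem h1, h2, h⟩
    · intro B h
      rw [e1]
      exact ⟨t, Finset.mem_insert_self _ _, Finset.mem_insert_self _ _,
        mY t (Finset.subset_insert _ _) h⟩
    · rintro B ⟨i, h1, hiB, h⟩
      rcases Finset.mem_insert.1 h1 with rfl | h1
      · refine Or.inr ⟨Finset.singleton_subset_iff.2 hiB, hY _ i _ (mY _ ?_ h)⟩
        intro v hv
        by_cases hvi : v = Sum.inl i <;> simp [hvi, hv]
      · exact Or.inl ⟨i, h1, hiB, h⟩

/-- the condition dual to the vertex `l` -/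
def YY (l : ι) (B : Finset (ι ⊕ ι)) : Prop := ∃ j, j ≠ l ∧ Sum.inr j ∈ B

lemma YY_mono (l : ι) : Monotone (YY l) := by
  rintro B B' h ⟨j, hj, h1⟩
  exact ⟨j, hj, h h1⟩

lemma HasB_N (hw : ∀ v, 1 ≤ w v) (A : Finset ι) (hA : A.Nonempty) :
    ∃ p : Polynomial ℕ, HasB (mI K (ι ⊕ ι)) (sq K w (fun B => ∀ l ∈ A, YY l B)) p ∧
      Polynomial.X ^ 2 * p + Polynomial.X + (1 + Polynomial.X) ^ (Fintype.card ι) =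
        (1 + Polynomial.X) ^ (Fintype.card ι - A.card + 1) +
        A.card • (Polynomial.X * (1 + Polynomial.X) ^ (Fintype.card ι - 1)) := by
  obtain ⟨q, hq, e⟩ := HasB_V (K := K) w hw (A.map Function.Embedding.inr)
  obtain ⟨p, hp, e'⟩ := add_vars (K := K) w hw (VV_mono _) (by simp [VV]) hq
    (Aᶜ.map Function.Embedding.inr) (by
      rintro s hs B ⟨i, hi, j, hj, hij, h1, h2⟩
      have : s ∉ A.map (Function.Embedding.inr (α := ι)) := by
        intro h
        obtain ⟨a, ha, rfl⟩ := Finset.mem_map.1 hs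
        obtain ⟨b, hb, h⟩ := Finset.mem_map.1 h
        have : b = a := Function.Embedding.inr.injective h
        rw [Finset.mem_compl] at ha
        exact ha (this ▸ hb)
      refine ⟨i, hi, j, hj, hij, ?_, ?_⟩
      · rcases Finset.mem_insert.1 h1 with rfl | h
        · exact absurd hi this
        · exact h
      · rcases Finset.mem_insert.1 h2 with rfl | h
        · exact absurd hj this
        · exact h)
  refine ⟨p, ?_, ?_⟩
  · rwa [sq_congr (K := K) w (ψ := fun B => ∀ l ∈ A, YY l B)] at hp
    intro B
    constructor
    · rintro (⟨i, hi, j, hj, hij, h1, h2⟩ | ⟨j, hj, h⟩) l hl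
      · obtain ⟨i, hi, rfl⟩ := Finset.mem_map.1 hi
        obtain ⟨j, hj, rfl⟩ := Finset.mem_map.1 hj
        by_cases h : i = l
        · refine ⟨j, ?_, h2⟩
          rintro rfl
          exact hij (by rw [h])
        · exact ⟨i, h, h1⟩
      · obtain ⟨j, hj', rfl⟩ := Finset.mem_map.1 hj
        rw [Finset.mem_compl] at hj'
        exact ⟨j, fun h => hj' (h ▸ hl), h⟩
    · intro h
      obtain ⟨l, hl⟩ := hA
      obtain ⟨j, _, hjB⟩ := h l hl
      by_cases hj : j ∈ A
      · obtain ⟨i, hij, hiB⟩ := h j hj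
        by_cases hi : i ∈ A
        · exact Or.inl ⟨Sum.inr i, Finset.mem_map.2 ⟨i, hi, rfl⟩, Sum.inr j,
            Finset.mem_map.2 ⟨j, hj, rfl⟩, fun h => hij (Sum.inr_injective h), hiB, hjB⟩
        · exact Or.inr ⟨Sum.inr i, Finset.mem_map.2 ⟨i, Finset.mem_compl.2 hi, rfl⟩, hiB⟩
      · exact Or.inr ⟨Sum.inr j, Finset.mem_map.2 ⟨j, Finset.mem_compl.2 hj, rfl⟩, hjB⟩
  · rw [Finset.card_map] at e e'
    rw [Finset.card_compl] at e'
    have hle : A.card ≤ Fintype.card ι := Finset.card_le_univ A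
    have hc : 0 < A.card := Finset.card_pos.2 hA
    obtain ⟨a, ha⟩ := Nat.exists_eq_succ_of_ne_zero hc.ne'
    obtain ⟨b, hb⟩ := Nat.exists_eq_add_of_le hle
    have e3 : Fintype.card ι - A.card = b := by omega
    have e4 : Fintype.card ι - 1 = b + a := by omega
    have e5 : A.card - 1 = a := by omega
    rw [e3] at e' ⊢
    rw [e4, hb]
    rw [e5] at e
    calc _ = Polynomial.X * (1 + Polynomial.X * p) + (1 + Polynomial.X) ^ (A.card + b) := by ring
      _ = (1 + Polynomial.X) ^ b * (Polynomial.X +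
        (Polynomial.X ^ 2 * q + (1 + Polynomial.X) ^ A.card)) := by rw [e', pow_add]; ring
      _ = _ := by rw [e, nsmul_eq_mul, nsmul_eq_mul]; ring

lemma HasB_crown (hw : ∀ v, 1 ≤ w v) :
    ∃ p : Finset ι → Polynomial ℕ, 
      HasB (mI K (ι ⊕ ι)) (sq K w (Ed Finset.univ YY))
        (∑ A ∈ Finset.univ.powerset.erase ∅, Polynomial.X ^ (A.card - 1) * p A) ∧
      ∀ A, A.Nonempty → 
      Polynomial.X ^ 2 * p A + Polynomial.X + (1 + Polynomial.X) ^ (Fintype.card ι) =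
        (1 + Polynomial.X) ^ (Fintype.card ι - A.card + 1) +
        A.card • (Polynomial.X * (1 + Polynomial.X) ^ (Fintype.card ι - 1)) := by
  have := fun A : Finset ι => fun hA : A.Nonempty => HasB_N (K := K) w hw A hA
  choose! p hp he using this
  refine ⟨p, HasB_E w hw _ YY YY_mono ?_ p (fun A _ hA => hp A hA), he⟩
  rintro i k B ⟨j, hj, h⟩
  exact ⟨j, hj, by simpa using h⟩

end layer5

section layer6
variable {K : Type} [Field K] {σ : Type} [Fintype σ] [DecidableEq σ]

/-- the image of the differential -/
noncomputable abbrev Zr {I : Ideal (MvPolynomial σ K)} (F : MinFreeRes I) (j : ℕ) :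
    Submodule (MvPolynomial σ K) (Fin (F.rk j) → MvPolynomial σ K) :=
  LinearMap.range (Matrix.mulVecLin (F.d j))

lemma Zr_mem {I : Ideal (MvPolynomial σ K)} (F : MinFreeRes I) (j : ℕ) (x : Zr F j)
    (k : Fin (F.rk j)) : (x : Fin (F.rk j) → MvPolynomial σ K) k ∈ mI K σ := by
  obtain ⟨_, y, rfl⟩ := x
  simp only [Matrix.mulVecLin_apply, Matrix.mulVec, dotProduct]
  refine Ideal.sum_mem _ fun l _ => Ideal.mul_mem_right _ _ ?_
  rw [RingHom.mem_ker, constantCoeff_eq]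
  exact F.minimal j k l

lemma bt_Zr {I : Ideal (MvPolynomial σ K)} (F : MinFreeRes I) (i : ℕ) : ∀ j,
    bt (R := MvPolynomial σ K) (MvPolynomial σ K ⧸ mI K σ) (Zr F j) i = F.rk (j + 1 + i) := by
  have key : ∀ j, _ := fun j => bt_cover (mI K σ) (Zr F (j + 1)).subtype
    (Matrix.mulVecLin (F.d j)).rangeRestrict (Submodule.subtype_injective _) (by
      rw [LinearMap.exact_iff, LinearMap.ker_rangeRestrict, Submodule.range_subtype]
      exact (F.exact_succ j).symm) (LinearMap.surjective_rangeRestrict _)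
      (fun x k => Zr_mem F (j + 1) x k)
  induction i with
  | zero => exact fun j => (key j).1
  | succ i ih =>
    intro j
    rw [(key j).2 i, ih (j + 1)]
    congr 2
    omega

lemma bt_res {I : Ideal (MvPolynomial σ K)} (F : MinFreeRes I) (i : ℕ) :
    bt (R := MvPolynomial σ K) (MvPolynomial σ K ⧸ mI K σ) I i = F.rk i := by
  have hr : LinearMap.range F.aug = I := by ext p; exact F.range_aug p
  have key := bt_cover (mI K σ) (Zr F 0).subtype
    F.aug.rangeRestrict (Submodule.subtype_injective _) (by
      rw [LinearMap.exact_iff, LinearMap.ker_rangeRestrict, Submodule.range_subtype]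
      exact F.exact_zero.symm) (LinearMap.surjective_rangeRestrict _)
      (fun x k => Zr_mem F 0 x k)
  rw [hr] at key
  cases i with
  | zero => exact key.1
  | succ i =>
    rw [key.2 i, bt_Zr F i 0]
    congr 2
    omega

end layer6

section layer7

lemma crown_ideal {K : Type} [Field K] (n : ℕ) (w : Fin n → ℕ) :
    Ideal.span {p : MvPolynomial (Fin n ⊕ Fin n) K | ∃ i j : Fin n, i ≠ j ∧
      p = X (Sum.inl i) * X (Sum.inr j) ^ w j} =
    sq K (Sum.elim (fun _ => 1) w) (Ed Finset.univ YY) := by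
  have hX : ∀ i j : Fin n, (X (Sum.inl i) * X (Sum.inr j) ^ w j : MvPolynomial (Fin n ⊕ Fin n) K) =
      monomial (Finsupp.single (Sum.inl i) 1 + Finsupp.single (Sum.inr j) (w j)) 1 := by
    intro i j
    rw [X_pow_eq_monomial, X, monomial_mul, one_mul]
  have mE : Monotone (Ed (Finset.univ : Finset (Fin n)) YY) := Ed_mono _ YY_mono
  apply le_antisymm
  · rw [Ideal.span_le]
    rintro _ ⟨i, j, hij, rfl⟩
    rw [hX, SetLike.mem_coe, mem_sq _ mE]
    intro a ha
    have := support_monomial_subset ha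
    rw [Finset.mem_singleton] at this
    subst this
    refine ⟨i, Finset.mem_univ _, ?_, j, hij.symm, ?_⟩
    · rw [mem_Tm]; simp
    · rw [mem_Tm]; simp
  · intro p hp
    rw [mem_sq _ mE] at hp
    rw [p.as_sum]
    refine Ideal.sum_mem _ fun a ha => ?_
    obtain ⟨i, _, h1, j, hij, h2⟩ := hp a ha
    rw [mem_Tm] at h1 h2
    simp only [Sum.elim_inl, Sum.elim_inr] at h1 h2
    have hle : Finsupp.single (Sum.inl i) 1 + Finsupp.single (Sum.inr j) (w j) ≤ a := by
      intro v
      rw [Finsupp.add_apply]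
      rcases v with v | v
      · by_cases hv : i = v
        · subst hv; simpa using h1
        · simp [hv]
      · by_cases hv : j = v
        · subst hv; simpa using h2
        · simp [hv]
    have : monomial a (coeff a p) =
        monomial (a - (Finsupp.single (Sum.inl i) 1 + Finsupp.single (Sum.inr j) (w j)))
          (coeff a p) * (X (Sum.inl i) * X (Sum.inr j) ^ w j) := by
      rw [hX, monomial_mul, mul_one, tsub_add_cancel_of_le hle]
    rw [this]
    exact Ideal.mul_mem_left _ _ (Ideal.subset_span ⟨i, j, hij.symm, rfl⟩)

end layer7

end CrownBetti

namespace Polynomial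

lemma crown_sum_mul_choose (x y : ℤ[X]) (k : ℕ) :
    ∑ m ∈ Finset.range (k + 1 + 1), ((k + 1).choose m : ℤ[X]) * (m * (x ^ m * y ^ (k + 1 - m))) =
      (k + 1) * x * (x + y) ^ k := by
  rw [Finset.sum_range_succ', add_pow, Finset.mul_sum]
  simp only [Nat.cast_zero, zero_mul, mul_zero, add_zero]
  refine Finset.sum_congr rfl fun m _ => ?_
  have h : ((k : ℤ[X]) + 1) * (k.choose m) = ((k + 1).choose (m + 1)) * (m + 1) := by
    exact_mod_cast congrArg (Nat.cast (R := ℤ[X])) (Nat.add_one_mul_choose_eq k m)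
  rw [Nat.add_sub_add_right]
  push_cast
  linear_combination (-(x ^ (m + 1) * y ^ (k - m))) * h

lemma crown_coeff_two (m j : ℕ) : ((1 + 2 * X : ℤ[X]) ^ m).coeff j = 2 ^ j * m.choose j := by
  have : (1 + 2 * X : ℤ[X]) ^ m = ((1 + X) ^ m : ℤ[X]).comp (C 2 * X) := by
    simp
  rw [this, comp_C_mul_X_coeff, coeff_one_add_X_pow, mul_comm]

lemma crown_target_coeff (n i : ℕ) :
    (((∑ k ∈ Finset.Icc 2 n,
        if 2 * k ≤ i + 3 then
          (k - 1) * 2 ^ (i + 3 - 2 * k) * n.choose k * (n - k).choose (i + 3 - 2 * k)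
        else 0) +
      (2 ^ (i + 2) - 2) * n.choose (i + 2) : ℕ) : ℤ) =
    (X * ((1 + 2 * X) ^ n - 2 * (1 + X) ^ n + 1) +
      ∑ k ∈ Finset.Icc 2 n, ((k : ℤ) - 1) • ((n.choose k : ℤ) • (X ^ (2 * k) *
        (1 + 2 * X) ^ (n - k))) : ℤ[X]).coeff (i + 3) := by
  have h2 : 2 ≤ 2 ^ (i + 2) := by
    calc 2 = 2 ^ 1 := rfl
      _ ≤ _ := Nat.pow_le_pow_right (by norm_num) (by omega)
  rw [coeff_add, coeff_X_mul, finsetSum_coeff, add_comm]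
  push_cast [Nat.cast_sub h2]
  congr 1
  · rw [coeff_add, coeff_sub, crown_coeff_two, coeff_one, if_neg (by omega),
      show (2 : ℤ[X]) = C 2 from rfl, coeff_C_mul, coeff_one_add_X_pow]
    ring
  · refine Finset.sum_congr rfl fun k hk => ?_
    rw [Finset.mem_Icc] at hk
    rw [coeff_smul, coeff_smul, coeff_X_pow_mul']
    split_ifs
    · rw [crown_coeff_two, Nat.cast_sub (by omega)]
      simp only [smul_eq_mul]
      push_cast
      ring
    · simp

lemma crown_target_sum (k : ℕ) :
    (∑ m ∈ Finset.Icc 2 (k + 1), ((m : ℤ) - 1) • (((k + 1).choose m : ℤ) • (X ^ (2 * m) *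
        (1 + 2 * X) ^ (k + 1 - m))) : ℤ[X]) =
      ((k : ℤ[X]) + 1) * X ^ 2 * ((1 + X) ^ k) ^ 2 - ((1 + X) ^ (k + 1)) ^ 2 + (1 + 2 * X) ^ (k + 1) := by
  have h1 := crown_sum_mul_choose (X ^ 2) (1 + 2 * X) k
  have h2 := add_pow (X ^ 2 : ℤ[X]) (1 + 2 * X) (k + 1)
  have hz : (X ^ 2 + (1 + 2 * X) : ℤ[X]) = (1 + X) ^ 2 := by ring
  rw [hz, pow_right_comm] at h1 h2
  have h3 : Finset.range (k + 1 + 1) = insert 0 (insert 1 (Finset.Icc 2 (k + 1))) := by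
    ext a; simp only [Finset.mem_range, Finset.mem_insert, Finset.mem_Icc]; omega
  rw [← h1, h2, ← Finset.sum_sub_distrib, h3, Finset.sum_insert (by simp),
    Finset.sum_insert (by simp)]
  have h4 : ∀ m ∈ Finset.Icc 2 (k + 1),
     (((m : ℤ) - 1) • (((k + 1).choose m : ℤ) • (X ^ (2 * m) *
        (1 + 2 * X) ^ (k + 1 - m))) : ℤ[X]) =
     ((k + 1).choose m : ℤ[X]) * ((m : ℤ[X]) * ((X ^ 2) ^ m * (1 + 2 * X) ^ (k + 1 - m))) -
       (X ^ 2) ^ m * (1 + 2 * X) ^ (k + 1 - m) * ((k + 1).choose m : ℤ[X]) := by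
    intro m _
    rw [zsmul_eq_mul, zsmul_eq_mul, pow_mul]
    push_cast
    ring
  rw [Finset.sum_congr rfl h4]
  simp
  ring

lemma crown_poly {ι : Type} [Fintype ι] [DecidableEq ι] (k : ℕ) (hk : Fintype.card ι = k + 1)
    (p : Finset ι → ℕ[X])
    (hp : ∀ A, A.Nonempty → 
      X ^ 2 * p A + X + (1 + X) ^ (Fintype.card ι) =
        (1 + X) ^ (Fintype.card ι - A.card + 1) +
        A.card • (X * (1 + X) ^ (Fintype.card ι - 1))) :
    X ^ 3 * (∑ A ∈ Finset.univ.powerset.erase ∅, X ^ (A.card - 1) * p A).map (Nat.castRingHom ℤ) =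
    (X * ((1 + 2 * X) ^ (k + 1) - 2 * (1 + X) ^ (k + 1) + 1) +
      ∑ m ∈ Finset.Icc 2 (k + 1), ((m : ℤ) - 1) • (((k + 1).choose m : ℤ) • (X ^ (2 * m) *
        (1 + 2 * X) ^ (k + 1 - m))) : ℤ[X]) := by
  rw [crown_target_sum, Polynomial.map_sum, Finset.mul_sum]
  let f : ℕ → ℤ[X] := fun m => X ^ m * ((1 + X) ^ (k + 1 - m) * (1 + X) +
    (m : ℤ[X]) * (X * (1 + X) ^ k) - X - (1 + X) ^ (k + 1))
  have h1 : ∀ A ∈ (Finset.univ : Finset ι).powerset.erase ∅,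
      X ^ 3 * (X ^ (A.card - 1) * p A).map (Nat.castRingHom ℤ) = f A.card := by
    intro A hA
    have hne : A.Nonempty := Finset.nonempty_iff_ne_empty.2 (Finset.mem_erase.1 hA).1
    have e := congrArg (Polynomial.map (Nat.castRingHom ℤ)) (hp A hne)
    obtain ⟨a, ha⟩ := Nat.exists_eq_succ_of_ne_zero (Finset.card_pos.2 hne).ne'
    rw [hk, ha] at e
    simp only [Polynomial.map_add, Polynomial.map_mul, Polynomial.map_pow, Polynomial.map_X,
      Polynomial.map_one, nsmul_eq_mul, Polynomial.map_natCast, Nat.add_sub_cancel] at e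
    simp only [Polynomial.map_mul, Polynomial.map_pow, Polynomial.map_X, f, ha,
      Nat.succ_eq_add_one, Nat.add_sub_cancel] at e ⊢
    linear_combination X ^ (a + 1) * e
  rw [Finset.sum_congr rfl h1, Finset.sum_erase_eq_sub (Finset.empty_mem_powerset _),
    Finset.sum_powerset_apply_card, Finset.card_univ, hk]
  have h2 := crown_sum_mul_choose X 1 k
  have h3 := add_pow (X : ℤ[X]) (1 + X) (k + 1)
  have h4 := add_pow (X : ℤ[X]) 1 (k + 1)
  have h5 : ∑ m ∈ Finset.range (k + 1 + 1), (k + 1).choose m • f m =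
      (1 + X) * (X + (1 + X)) ^ (k + 1) + X * (1 + X) ^ k * (((k : ℤ[X]) + 1) * X * (X + 1) ^ k) -
      (X + (1 + X) ^ (k + 1)) * (X + 1) ^ (k + 1) := by
    rw [← h2, h3, h4, Finset.mul_sum, Finset.mul_sum, Finset.mul_sum, ← Finset.sum_add_distrib,
      ← Finset.sum_sub_distrib]
    refine Finset.sum_congr rfl fun m _ => ?_
    simp only [f, nsmul_eq_mul, one_pow]
    ring
  rw [h5]
  simp only [f, Finset.card_empty]
  rw [show (X + (1 + X) : ℤ[X]) = 1 + 2 * X by ring, show (X + 1 : ℤ[X]) = 1 + X by ring]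
  simp only [Nat.sub_zero, Nat.cast_zero]
  ring

end Polynomial

/-- For the edge ideal `I_n` of the weighted oriented crown graph `G_n` (`n ≥ 2`),
for every `i ≥ 0`,
`β_i(I_n) = Σ_{k=2}^n (k-1)·2^(i+3-2k)·C(n,k)·C(n-k,i+3-2k) + (2^(i+2)-2)·C(n,i+2)`
(terms with `i + 3 < 2k` vanish).  In particular `β_i(I_n)` is independent of the
weights `w_1,…,w_n`. -/
theorem stmt17 {K : Type} [Field K] (n : ℕ) (hn : 2 ≤ n)
    (w : Fin n → ℕ) (hw : ∀ j, 1 ≤ w j)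
    (I : Ideal (MvPolynomial (Fin n ⊕ Fin n) K))
    (hI : I = Ideal.span {p | ∃ i j : Fin n, i ≠ j ∧
      p = X (Sum.inl i) * X (Sum.inr j) ^ w j})
    (F : MinFreeRes I) :
    ∀ i, F.rk i =
      (∑ k ∈ Finset.Icc 2 n,
        if 2 * k ≤ i + 3 then
          (k - 1) * 2 ^ (i + 3 - 2 * k) * n.choose k * (n - k).choose (i + 3 - 2 * k)
        else 0) +
      (2 ^ (i + 2) - 2) * n.choose (i + 2) := by
  intro i
  obtain ⟨k, rfl⟩ : ∃ k, n = k + 1 := ⟨n - 1, by omega⟩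
  have hw' : ∀ v, 1 ≤ (Sum.elim (fun _ => 1) w : Fin (k + 1) ⊕ Fin (k + 1) → ℕ) v := by
    rintro (v | v)
    · exact le_rfl
    · exact hw v
  obtain ⟨p, hB, hp⟩ := CrownBetti.HasB_crown (K := K) _ hw'
  rw [← CrownBetti.crown_ideal, ← hI] at hB
  have h1 := CrownBetti.bt_res F i
  rw [hB i] at h1
  have h2 := Polynomial.crown_poly k (Fintype.card_fin _) p hp
  have h3 := congrArg (fun q => Polynomial.coeff q (i + 3)) h2
  simp only [Polynomial.coeff_X_pow_mul, Polynomial.coeff_map] at h3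
  rw [← Polynomial.crown_target_coeff (k + 1) i] at h3
  have h4 := Nat.cast_injective h1
  rw [← h4]
  exact Nat.cast_injective (R := ℤ) h3
end
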